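/- arXiv:2302.04673 — 2 statements merged into one kernel-verified Lean document; each statement's English description precedes it below -/
import Mathlib

section
/- The universal sphere bundle E*_{m,n} := {(X,y,t) ∈ G_{m,n} × ℝ^{m+n} × ℝ : Xy = y and |y|² + t² = t} is a projectively ℚ-closed ℚ-nonsingular ℚ-algebraic subset of ℝ^{(m+n)² + m + n + 1} of dimension m(n+1). -/
open MvPolynomial

noncomputable section

variable {ι κ : Type*} [Fintype ι] [DecidableEq ι] [Fintype κ]

/-- `V ⊆ ℝ^ι` is a `ℚ`-algebraic set: the common zero set of finitely many
polynomials with rational coefficients. -/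
def IsQAlgebraicSet (V : Set (ι → ℝ)) : Prop :=
  ∃ S : Finset (MvPolynomial ι ℚ), V = {x : ι → ℝ | ∀ p ∈ S, aeval x p = 0}

/-- The gradient of a polynomial with rational coefficients at a real point. -/
def polyGradQ (p : MvPolynomial ι ℚ) (a : ι → ℝ) : ι → ℝ :=
  fun i => aeval a (pderiv i p)

/-- `V` is a `d`-dimensional `C^∞` submanifold of `ℝ^ι`: near each of its points it is
the regular zero set of a `C^∞` submersion with values in `ℝ^(card ι - d)`. -/
def IsSmoothSubmanifold (d : ℕ) (V : Set (ι → ℝ)) : Prop :=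
  ∀ a ∈ V, ∃ (U : Set (ι → ℝ)) (f : (ι → ℝ) → (Fin (Fintype.card ι - d) → ℝ)),
    IsOpen U ∧ a ∈ U ∧ ContDiffOn ℝ (⊤ : ℕ∞) f U ∧
    (∀ x ∈ U, Function.Surjective (fderiv ℝ f x)) ∧
    V ∩ U = {x ∈ U | f x = 0}

/-- `V` is a `ℚ`-nonsingular `ℚ`-algebraic set of dimension `d`. -/
def IsQNonsingular (d : ℕ) (V : Set (ι → ℝ)) : Prop :=
  IsQAlgebraicSet V ∧ IsSmoothSubmanifold d V ∧
    ∀ a ∈ V, ∃ q : Fin (Fintype.card ι - d) → MvPolynomial ι ℚ,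
      (∀ j, ∀ x ∈ V, aeval x (q j) = 0) ∧
      LinearIndependent ℝ (fun j => polyGradQ (q j) a) ∧
      ∃ U : Set (ι → ℝ), IsOpen U ∧ a ∈ U ∧
        V ∩ U = {x ∈ U | ∀ j, aeval x (q j) = 0}

/-- A real polynomial is overt if the zero set of its top-degree homogeneous
component is contained in `{0}`. -/
def IsOvert (p : MvPolynomial ι ℝ) : Prop :=
  ∀ x : ι → ℝ, eval x (homogeneousComponent p.totalDegree p) = 0 → x = 0

/-- `V` is projectively `ℚ`-closed: the zero set of a single overt polynomial with
rational coefficients. -/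
def IsProjQClosed (V : Set (ι → ℝ)) : Prop :=
  ∃ p : MvPolynomial ι ℚ, IsOvert (MvPolynomial.map (algebraMap ℚ ℝ) p) ∧
    V = {x : ι → ℝ | aeval x p = 0}

/-- `V ⊆ ℝ^ι` is a real algebraic set. -/
def IsRAlgebraicSet (V : Set (ι → ℝ)) : Prop :=
  ∃ S : Finset (MvPolynomial ι ℝ), V = {x : ι → ℝ | ∀ p ∈ S, eval x p = 0}

/-- The gradient of a real polynomial at a point. -/
def polyGradR (p : MvPolynomial ι ℝ) (a : ι → ℝ) : ι → ℝ :=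
  fun i => eval a (pderiv i p)

/-- `V` is a nonsingular real algebraic set of dimension `d`. -/
def IsNonsingularRAlgebraic (d : ℕ) (V : Set (ι → ℝ)) : Prop :=
  IsRAlgebraicSet V ∧ IsSmoothSubmanifold d V ∧
    ∀ a ∈ V, ∃ q : Fin (Fintype.card ι - d) → MvPolynomial ι ℝ,
      (∀ j, ∀ x ∈ V, eval x (q j) = 0) ∧
      LinearIndependent ℝ (fun j => polyGradR (q j) a) ∧
      ∃ U : Set (ι → ℝ), IsOpen U ∧ a ∈ U ∧
        V ∩ U = {x ∈ U | ∀ j, eval x (q j) = 0}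

/-- The tangent space of `M` at `a`, realized as the span of the tangent cone. -/
def tangentSpan (M : Set (ι → ℝ)) (a : ι → ℝ) : Submodule ℝ (ι → ℝ) :=
  Submodule.span ℝ (tangentConeAt ℝ M a)

/-- The submanifolds `Ms i` of `M`, of codimensions `c i`, are in general position. -/
def InGeneralPosition {ℓ : ℕ} (M : Set (ι → ℝ)) (Ms : Fin ℓ → Set (ι → ℝ))
    (c : Fin ℓ → ℕ) : Prop :=
  ∀ α : Finset (Fin ℓ), α.Nonempty → ∀ a : ι → ℝ, (∀ i ∈ α, a ∈ Ms i) →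
    Module.finrank ℝ ↥(⨅ i ∈ α, tangentSpan (Ms i) a) + ∑ i ∈ α, c i
      = Module.finrank ℝ ↥(tangentSpan M a)

/-- A `ℚ`-regular map on `S`: each component is a quotient of polynomials with
rational coefficients whose denominator does not vanish on `S`. -/
def IsQRegularMap (S : Set (ι → ℝ)) (g : (ι → ℝ) → κ → ℝ) : Prop :=
  ∀ j : κ, ∃ p q : MvPolynomial ι ℚ, (∀ x ∈ S, aeval x q ≠ 0) ∧
    ∀ x ∈ S, g x j = aeval x p / aeval x q

/-- A map whose components are restrictions of polynomials with rational coefficients. -/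
def IsQPolynomialMap {κ' : Type*} (S : Set (ι → ℝ)) (g : (ι → ℝ) → κ' → ℝ) : Prop :=
  ∀ j : κ', ∃ p : MvPolynomial ι ℚ, ∀ x ∈ S, g x j = aeval x p

/-- `f` restricts to a `C^∞` diffeomorphism from `A` onto `B`. -/
def IsSmoothDiffeoOn (f : (ι → ℝ) → κ → ℝ) (A : Set (ι → ℝ)) (B : Set (κ → ℝ)) : Prop :=
  Set.BijOn f A B ∧ ContDiffOn ℝ (⊤ : ℕ∞) f A ∧
    ∃ g : (κ → ℝ) → ι → ℝ, ContDiffOn ℝ (⊤ : ℕ∞) g B ∧ Set.InvOn g f A B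

/-- `L` is a `ℚ`-nice `ℚ`-algebraic set. -/
def IsQNice (L : Set (ι → ℝ)) : Prop :=
  ∀ a ∈ L, ∃ U : Set (ι → ℝ), IsOpen U ∧ a ∈ U ∧
    ∀ f : (ι → ℝ) → ℝ, ContDiff ℝ (⊤ : ℕ∞) f → (∀ x ∈ L, f x = 0) →
      ∃ (s : ℕ) (pp : Fin s → MvPolynomial ι ℚ) (u : Fin s → (ι → ℝ) → ℝ),
        (∀ i, ∀ x ∈ L, aeval x (pp i) = 0) ∧
        (∀ i, ContDiffOn ℝ (⊤ : ℕ∞) (u i) U) ∧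
        ∀ x ∈ U, f x = ∑ i, u i x * aeval x (pp i)

/-- Inclusion `ℝ^a ⊆ ℝ^b` via the first `a` coordinates. -/
def inclZero {a b : ℕ} (_ : a ≤ b) (x : Fin a → ℝ) : Fin b → ℝ :=
  fun j => if hj : (j : ℕ) < a then x ⟨j, hj⟩ else 0

/-- Reading a point of `ℝ^(k×k)` as a `k × k` matrix. -/
def matOf {k : ℕ} (x : Fin k × Fin k → ℝ) : Matrix (Fin k) (Fin k) ℝ :=
  Matrix.of fun i j => x (i, j)

/-- The symmetric idempotent matrices of size `k` and trace `r`. -/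
def GrassMatrix (k r : ℕ) : Set (Matrix (Fin k) (Fin k) ℝ) :=
  {X | X.transpose = X ∧ X * X = X ∧ X.trace = (r : ℝ)}

/-- The Grassmannian `G_{m,n}` embedded in `ℝ^{(m+n)²}`. -/
def Grass (m n : ℕ) : Set (Fin (m + n) × Fin (m + n) → ℝ) :=
  {x | matOf x ∈ GrassMatrix (m + n) m}

/-- The diagonal matrix `D_ℓ` with `1` in the first `ℓ` diagonal entries and `0` elsewhere. -/
def stdProj (k ℓ : ℕ) : Matrix (Fin k) (Fin k) ℝ :=
  Matrix.diagonal fun i => if (i : ℕ) < ℓ then 1 else 0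

/-- The coordinate subspace `ℝ^ℓ ⊆ ℝ^k` (first `ℓ` coordinates). -/
def coordSubspace (k ℓ : ℕ) : Submodule ℝ (Fin k → ℝ) :=
  ⨅ i ∈ {i : Fin k | ℓ ≤ (i : ℕ)},
    LinearMap.ker (LinearMap.proj (R := ℝ) (φ := fun _ : Fin k => ℝ) i)

/-- The column space of a square matrix. -/
def colSpace {k : ℕ} (X : Matrix (Fin k) (Fin k) ℝ) : Submodule ℝ (Fin k → ℝ) :=
  LinearMap.range X.mulVecLin

/-- `lam` is a partition inside the `m × n` rectangle. -/
def IsPartitionIn (n : ℕ) {m : ℕ} (lam : Fin m → ℕ) : Prop :=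
  (∀ k, lam k ≤ n) ∧ Antitone lam

/-- The Schubert variety `σ_λ ⊆ G_{m,n}` with respect to the canonical complete flag. -/
def SchubertVariety (m n : ℕ) (lam : Fin m → ℕ) :
    Set (Fin (m + n) × Fin (m + n) → ℝ) :=
  {x | x ∈ Grass m n ∧ ∀ k : Fin m,
    ((matOf x - 1) * stdProj (m + n) (n + ((k : ℕ) + 1) - lam k)).rank ≤ n - lam k}

/-- `λ_{k+1}`, with the convention `λ_{m+1} = 0`. -/
def lamNext {m : ℕ} (lam : Fin m → ℕ) (k : Fin m) : ℕ :=
  if h : (k : ℕ) + 1 < m then lam ⟨(k : ℕ) + 1, h⟩ else 0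

/-- The open Schubert cell `Ω_λ ⊆ G_{m,n}` with respect to the canonical complete flag. -/
def SchubertCell (m n : ℕ) (lam : Fin m → ℕ) :
    Set (Fin (m + n) × Fin (m + n) → ℝ) :=
  {x | x ∈ Grass m n ∧ ∀ k : Fin m, ∀ ℓ : ℕ,
    n + ((k : ℕ) + 1) - lam k ≤ ℓ → ℓ ≤ n + ((k : ℕ) + 1) - lamNext lam k →
    Module.finrank ℝ ↥(colSpace (matOf x) ⊓ coordSubspace (m + n) ℓ) = (k : ℕ) + 1}

/-- `f 0 + ⋯ + f (t-1)` for `f : Fin c → ℕ`. -/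
def partialSum {c : ℕ} (f : Fin c → ℕ) (t : ℕ) : ℕ :=
  ∑ i ∈ Finset.univ.filter (fun i : Fin c => (i : ℕ) < t), f i

/-- The `j`-th matrix slot of a point of `(ℝ^{k×k})^c`. -/
def matSlot {c k : ℕ} (z : Fin c × (Fin k × Fin k) → ℝ) (j : Fin c) :
    Matrix (Fin k) (Fin k) ℝ :=
  Matrix.of fun p q => z (j, (p, q))

/-- The embedded Bott–Samelson set `Z_λ`, with slot `0` carrying `X` and slot `k`
(`1 ≤ k ≤ c-1`) carrying `Y_k`. -/
def BottSamelson (m n c : ℕ) (hc : 0 < c) (a b : Fin c → ℕ) :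
    Set (Fin c × (Fin (m + n) × Fin (m + n)) → ℝ) :=
  {z | matSlot z ⟨0, hc⟩ ∈ GrassMatrix (m + n) m ∧
    (∀ j : Fin c, 0 < (j : ℕ) →
      matSlot z j ∈ GrassMatrix (m + n) (partialSum a (j : ℕ)) ∧
      matSlot z j * stdProj (m + n) (partialSum a (j : ℕ) + partialSum b (j : ℕ))
        = matSlot z j) ∧
    (∀ (j : Fin c), 0 < (j : ℕ) → ∀ (h2 : (j : ℕ) + 1 < c),
      matSlot z ⟨(j : ℕ) + 1, h2⟩ * matSlot z j = matSlot z j) ∧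
    (∀ j : Fin c, 0 < (j : ℕ) → (j : ℕ) = c - 1 →
      matSlot z ⟨0, hc⟩ * matSlot z j = matSlot z j)}

end
/-- The universal sphere bundle `E*_{m,n}` over `G_{m,n}`, embedded in
`ℝ^{(m+n)² + (m+n) + 1}`. -/
def UnivSphereBundle (m n : ℕ) :
    Set ((Fin (m + n) × Fin (m + n)) ⊕ (Fin (m + n) ⊕ Unit) → ℝ) :=
  {z | (fun p => z (Sum.inl p)) ∈ Grass m n ∧
    (matOf fun p => z (Sum.inl p)).mulVec (fun i => z (Sum.inr (Sum.inl i)))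
      = (fun i => z (Sum.inr (Sum.inl i))) ∧
    (∑ i : Fin (m + n), z (Sum.inr (Sum.inl i)) ^ 2)
        + z (Sum.inr (Sum.inr ())) ^ 2 = z (Sum.inr (Sum.inr ()))}

section PolynomialCalculus

variable {ι : Type*} [Fintype ι]

/-- The directional derivative at `a` along `h` of a polynomial with rational coefficients. -/
noncomputable def dirDerivQ (a h : ι → ℝ) (p : MvPolynomial ι ℚ) : ℝ := polyGradQ p a ⬝ᵥ h

@[simp] lemma dirDerivQ_add (a h : ι → ℝ) (p q : MvPolynomial ι ℚ) :
    dirDerivQ a h (p + q) = dirDerivQ a h p + dirDerivQ a h q := by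
  simp [dirDerivQ, dotProduct, polyGradQ, add_mul, Finset.sum_add_distrib]

@[simp] lemma dirDerivQ_sub (a h : ι → ℝ) (p q : MvPolynomial ι ℚ) :
    dirDerivQ a h (p - q) = dirDerivQ a h p - dirDerivQ a h q := by
  simp [dirDerivQ, dotProduct, polyGradQ, sub_mul, Finset.sum_sub_distrib]

@[simp] lemma dirDerivQ_mul (a h : ι → ℝ) (p q : MvPolynomial ι ℚ) :
    dirDerivQ a h (p * q) = aeval a p * dirDerivQ a h q + aeval a q * dirDerivQ a h p := by
  simp [dirDerivQ, dotProduct, polyGradQ, add_mul, Finset.sum_add_distrib, Finset.mul_sum,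
    mul_assoc]

@[simp] lemma dirDerivQ_C (a h : ι → ℝ) (r : ℚ) : dirDerivQ a h (C r) = 0 := by
  simp [dirDerivQ, dotProduct, polyGradQ]

@[simp] lemma dirDerivQ_X (a h : ι → ℝ) (i : ι) : dirDerivQ a h (X i) = h i := by
  classical
  simp [dirDerivQ, dotProduct, polyGradQ, pderiv_X, Pi.single_apply, apply_ite]

@[simp] lemma dirDerivQ_sum {J : Type*} (a h : ι → ℝ) (s : Finset J) (p : J → MvPolynomial ι ℚ) :
    dirDerivQ a h (∑ j ∈ s, p j) = ∑ j ∈ s, dirDerivQ a h (p j) := by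
  classical
  induction s using Finset.induction_on with
  | empty => simp [dirDerivQ, dotProduct, polyGradQ]
  | insert j s hj ih => simp [Finset.sum_insert hj, ih]

lemma contDiff_aeval_mvPolynomial (p : MvPolynomial ι ℚ) (n : WithTop ℕ∞) :
    ContDiff ℝ n fun x : ι → ℝ => aeval x p := by
  induction p using MvPolynomial.induction_on with
  | C r => simpa using contDiff_const
  | add p q hp hq => simpa using hp.add hq
  | mul_X p i hp => simpa using hp.mul (contDiff_apply ℝ ℝ i)

lemma fderiv_aeval_mvPolynomial (p : MvPolynomial ι ℚ) (a h : ι → ℝ) :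
    fderiv ℝ (fun x : ι → ℝ => aeval x p) a h = dirDerivQ a h p := by
  have hd (q : MvPolynomial ι ℚ) : DifferentiableAt ℝ (fun x : ι → ℝ => aeval x q) a :=
    (contDiff_aeval_mvPolynomial q 1).differentiable one_ne_zero a
  induction p using MvPolynomial.induction_on with
  | C r => simp
  | add p q hp hq => simp [fderiv_fun_add (hd p) (hd q), hp, hq]
  | mul_X p i hp =>
    have hX := hd (X i)
    simp only [aeval_X] at hX
    simp [fderiv_fun_mul (hd p) hX, hp, fderiv_apply]

lemma continuous_polyGradQ (p : MvPolynomial ι ℚ) : Continuous (polyGradQ p) :=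
  continuous_pi fun i => (contDiff_aeval_mvPolynomial (pderiv i p) 0).continuous

lemma surjective_mulVec_of_linearIndependent {c : ℕ} {G : Fin c → ι → ℝ}
    (hG : LinearIndependent ℝ G) : Function.Surjective (Matrix.of G).mulVec := by
  have hr := LinearIndependent.rank_matrix (M := Matrix.of G) hG
  rw [Matrix.rank] at hr
  have : LinearMap.range (Matrix.of G).mulVecLin = ⊤ :=
    Submodule.eq_top_of_finrank_eq (by simp [hr])
  exact LinearMap.range_eq_top.mp this

lemma isSmoothSubmanifold_of_polynomials {d : ℕ} {V : Set (ι → ℝ)}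
    (hV : ∀ a ∈ V, ∃ q : Fin (Fintype.card ι - d) → MvPolynomial ι ℚ,
      LinearIndependent ℝ (fun j => polyGradQ (q j) a) ∧
      ∃ U : Set (ι → ℝ), IsOpen U ∧ a ∈ U ∧
        V ∩ U = {x ∈ U | ∀ j, aeval x (q j) = 0}) :
    IsSmoothSubmanifold d V := by
  intro a ha
  obtain ⟨q, hq, U, hU, haU, hVU⟩ := hV a ha
  have hcont : Continuous fun (x : ι → ℝ) j => polyGradQ (q j) x :=
    continuous_pi fun j => continuous_polyGradQ (q j)
  have hO : IsOpen {x : ι → ℝ | LinearIndependent ℝ fun j => polyGradQ (q j) x} :=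
    isOpen_setOfPred_linearIndependent.preimage hcont
  refine ⟨U ∩ {x | LinearIndependent ℝ fun j => polyGradQ (q j) x},
    fun x j => aeval x (q j), hU.inter hO, ⟨haU, hq⟩,
    (contDiff_pi.mpr fun j => contDiff_aeval_mvPolynomial _ _).contDiffOn, ?_, ?_⟩
  · rintro x ⟨-, hx⟩ w
    obtain ⟨h, hh⟩ := surjective_mulVec_of_linearIndependent hx w
    refine ⟨h, ?_⟩
    rw [← hh]
    ext j
    have hd (j) : DifferentiableAt ℝ (fun x : ι → ℝ => aeval x (q j)) x :=
      (contDiff_aeval_mvPolynomial (q j) 1).differentiable one_ne_zero x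
    rw [fderiv_pi hd]
    exact fderiv_aeval_mvPolynomial (q j) x h
  · rw [← Set.inter_assoc, hVU]
    ext x
    simp only [Set.mem_inter_iff, Set.mem_ofPred_eq, funext_iff, Pi.zero_apply]
    tauto

/-- A finite family of polynomials whose differential at `a` has a kernel of dimension `d`, and
whose values satisfy linear relations `Ψ x` that cut out the image of that differential at `a`,
has a subfamily of independent equations with the same zeros near `a`. -/
lemma exists_independent_equations {J W : Type*} [Fintype J] [NormedAddCommGroup W]
    [NormedSpace ℝ W] {d : ℕ} {a : ι → ℝ} (g : J → MvPolynomial ι ℚ)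
    (T : Submodule ℝ (ι → ℝ)) (hT : ∀ h, h ∈ T ↔ ∀ j, dirDerivQ a h (g j) = 0)
    (hd : Module.finrank ℝ T = d)
    (Ψ : (ι → ℝ) → (J → ℝ) →ₗ[ℝ] W) (hΨ : ∀ w, Continuous fun x => Ψ x w)
    (hrel : ∀ x, Ψ x (fun j => aeval x (g j)) = 0)
    (hexact : ∀ w, Ψ a w = 0 → ∃ h, ∀ j, dirDerivQ a h (g j) = w j) :
    ∃ s : Fin (Fintype.card ι - d) → J,
      LinearIndependent ℝ (fun i => polyGradQ (g (s i)) a) ∧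
      ∃ U : Set (ι → ℝ), IsOpen U ∧ a ∈ U ∧
        ∀ x ∈ U, (∀ i, aeval x (g (s i)) = 0) → ∀ j, aeval x (g j) = 0 := by
  classical
  set G : J → ι → ℝ := fun j => polyGradQ (g j) a
  have hker : LinearMap.ker (Matrix.of G).mulVecLin = T := by
    ext h
    rw [hT, LinearMap.mem_ker, funext_iff]
    rfl
  have hrank : Module.finrank ℝ (Submodule.span ℝ (Set.range G)) = Fintype.card ι - d := by
    have h1 := LinearMap.finrank_range_add_finrank_ker (Matrix.of G).mulVecLin
    have h2 := Matrix.rank_eq_finrank_span_row (Matrix.of G)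
    rw [Matrix.rank] at h2
    rw [hker, hd, h2, Module.finrank_fintype_fun_eq_card] at h1
    change Module.finrank ℝ (Submodule.span ℝ (Set.range G)) + d = _ at h1
    omega
  obtain ⟨κ, s₀, hs₀, hspan, hli⟩ := exists_linearIndependent' ℝ G
  have : Fintype κ := Fintype.ofInjective s₀ hs₀
  have hcard : Fintype.card κ = Fintype.card ι - d := by
    rw [← hrank, ← hspan, finrank_span_eq_card hli]
  let e : Fin (Fintype.card ι - d) ≃ κ := (Fintype.equivFinOfCardEq hcard).symm
  refine ⟨s₀ ∘ e, hli.comp e e.injective, ?_⟩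
  set N : (ι → ℝ) → (J → ℝ) →ₗ[ℝ] (Fin (Fintype.card ι - d) → ℝ) × W :=
    fun x => (LinearMap.funLeft ℝ ℝ (s₀ ∘ e)).prod (Ψ x) with hN
  have hinj : LinearMap.ker (N a) = ⊥ := by
    rw [LinearMap.ker_eq_bot']
    intro w hw
    obtain ⟨hw1, hw2⟩ := Prod.ext_iff.mp hw
    obtain ⟨h, hh⟩ := hexact w hw2
    have hperp : ∀ v ∈ Submodule.span ℝ (Set.range (G ∘ s₀)), v ⬝ᵥ h = 0 := by
      intro v hv
      induction hv using Submodule.span_induction with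
      | mem v hv =>
        obtain ⟨i, rfl⟩ := hv
        have hi : w (s₀ (e (e.symm i))) = 0 := congrFun hw1 (e.symm i)
        rw [e.apply_symm_apply] at hi
        exact (hh (s₀ i)).trans hi
      | zero => simp
      | add u v _ _ hu hv => rw [add_dotProduct, hu, hv, add_zero]
      | smul r v _ hv => rw [smul_dotProduct, hv, smul_zero]
    ext j
    rw [← hh j]
    exact hperp _ (hspan ▸ Submodule.subset_span ⟨j, rfl⟩)
  set F : (ι → ℝ) → J → (Fin (Fintype.card ι - d) → ℝ) × W :=
    fun x j => N x (Pi.single j 1) with hF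
  have hFcont : Continuous F :=
    continuous_pi fun j => continuous_const.prodMk (hΨ (Pi.single j 1))
  have hli_iff (x) : LinearIndependent ℝ (F x) ↔ LinearMap.ker (N x) = ⊥ := by
    have hFx : F x = N x ∘ Pi.basisFun ℝ J := by
      ext1 j
      simp [hF]
    refine ⟨fun h => ?_, fun h => hFx ▸ (Pi.basisFun ℝ J).linearIndependent.map' _ h⟩
    rw [LinearMap.ker_eq_bot']
    intro w hw
    refine funext (Fintype.linearIndependent_iff.mp h w ?_)
    conv_rhs => rw [← hw, ← (Pi.basisFun ℝ J).sum_repr w, map_sum]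
    simp [hF]
  refine ⟨{x | LinearIndependent ℝ (F x)},
    isOpen_setOfPred_linearIndependent.preimage hFcont, (hli_iff a).mpr hinj, ?_⟩
  intro x hx hzero
  have := LinearMap.ker_eq_bot'.mp ((hli_iff x).mp hx) (fun j => aeval x (g j))
    (Prod.ext (funext fun i => hzero i) (hrel x))
  exact congrFun this

end PolynomialCalculus

section Overt

variable {ι : Type*}

/-- A real algebraic set cut out over `ℚ` on which an equation `N + l = 0` holds, with `N` a
definite form and `l` of lower degree, is projectively `ℚ`-closed. -/
lemma isProjQClosed_of_definite_relation [Nonempty ι] {J : Type*} [Fintype J]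
    {V : Set (ι → ℝ)} (g : J → MvPolynomial ι ℚ)
    (hV : V = {x | ∀ j, aeval x (g j) = 0}) {k : ℕ} (N l : MvPolynomial ι ℚ)
    (hN : N.IsHomogeneous k) (hN0 : ∀ x : ι → ℝ, aeval x N = 0 → x = 0)
    (hl : l.totalDegree < k) (hg : ∀ j, (g j).totalDegree < k)
    (hVN : ∀ x ∈ V, aeval x (N + l) = 0) :
    IsProjQClosed V := by
  set r : MvPolynomial ι ℚ := N * l + l * (N + l) + ∑ j, g j * g j with hr
  have hNd : N.totalDegree ≤ k := hN.totalDegree_le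
  have hrd : r.totalDegree < k + k := by
    refine (totalDegree_add _ _).trans_lt (max_lt ((totalDegree_add _ _).trans_lt
      (max_lt ?_ ?_)) ?_)
    · exact (totalDegree_mul _ _).trans_lt (by omega)
    · have := totalDegree_add N l
      exact (totalDegree_mul _ _).trans_lt (by omega)
    · have : (∑ j, g j * g j).totalDegree ≤ k + k - 1 :=
        totalDegree_finsetSum_le fun j _ =>
          (totalDegree_mul _ _).trans (by have := hg j; omega)
      omega
  have haeval (p : MvPolynomial ι ℚ) (x : ι → ℝ) :
      eval x (map (algebraMap ℚ ℝ) p) = aeval x p := by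
    rw [eval_map, aeval_def]
  have hmap (p : MvPolynomial ι ℚ) : (map (algebraMap ℚ ℝ) p).totalDegree = p.totalDegree := by
    simp only [totalDegree, support_map_of_injective p (algebraMap ℚ ℝ).injective]
  have htop : homogeneousComponent (k + k) (map (algebraMap ℚ ℝ) (N * N + r))
      = map (algebraMap ℚ ℝ) (N * N) := by
    rw [map_add, map_add, homogeneousComponent_eq_zero _ (map _ r) (by rwa [hmap]), add_zero,
      homogeneousComponent_of_mem (m := k + k) (n := k + k)
        ((mem_homogeneousSubmodule _ _).mpr ((hN.mul hN).map _)), if_pos rfl]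
  refine ⟨N * N + r, ?_, ?_⟩
  · have hdeg : (map (algebraMap ℚ ℝ) (N * N + r)).totalDegree = k + k := by
      refine le_antisymm ?_ (not_lt.mp fun hlt => ?_)
      · rw [hmap]
        refine (totalDegree_add _ _).trans (max_le ((totalDegree_mul _ _).trans ?_) hrd.le)
        omega
      · rw [homogeneousComponent_eq_zero _ _ hlt] at htop
        have h1 := hN0 1 (by
          have := haeval (N * N) 1
          rw [← htop, map_zero, map_mul] at this
          exact mul_self_eq_zero.mp this.symm)
        exact one_ne_zero (congrFun h1 (Classical.arbitrary ι))
    intro x hx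
    rw [hdeg, htop, haeval, map_mul] at hx
    exact hN0 x (mul_self_eq_zero.mp hx)
  · have hp (x : ι → ℝ) : aeval x (N * N + r) =
        aeval x (N + l) * aeval x (N + l) + ∑ j, aeval x (g j) * aeval x (g j) := by
      simp only [hr, map_add, map_mul, map_sum]
      ring
    ext x
    rw [Set.mem_ofPred_eq, hp]
    constructor
    · intro hx
      have h2 := hVN x hx
      rw [hV] at hx
      rw [h2, Finset.sum_eq_zero fun j _ => by rw [hx j, mul_zero]]
      simp
    · intro hx
      rw [hV]
      have hs : 0 ≤ ∑ j, aeval x (g j) * aeval x (g j) :=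
        Finset.sum_nonneg fun j _ => mul_self_nonneg _
      have h0 : ∑ j, aeval x (g j) * aeval x (g j) = 0 := by
        nlinarith [mul_self_nonneg (aeval x (N + l))]
      intro j
      exact mul_self_eq_zero.mp
        ((Finset.sum_eq_zero_iff_of_nonneg fun j _ => mul_self_nonneg _).mp h0 j
          (Finset.mem_univ j))

end Overt

section Idempotent

/-- An idempotent matrix `X` has a rank factorization `X = A * B` with `B * A = 1`, whose inner
dimension is the trace of `X`. -/
lemma exists_factorization_of_isIdempotent {k : ℕ} {X : Matrix (Fin k) (Fin k) ℝ}
    (hX : X * X = X) : ∃ (r : ℕ) (A : Matrix (Fin k) (Fin r) ℝ) (B : Matrix (Fin r) (Fin k) ℝ),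
      A * B = X ∧ B * A = 1 ∧ X.trace = r := by
  classical
  set f := Matrix.toLin' X with hf
  have hff (x) : f (f x) = f x := by
    simp only [hf, Matrix.toLin'_apply, Matrix.mulVec_mulVec, hX]
  let e : LinearMap.range f ≃ₗ[ℝ] (Fin (Module.finrank ℝ (LinearMap.range f)) → ℝ) :=
    LinearEquiv.ofFinrankEq _ _ (by simp)
  let u := (LinearMap.range f).subtype ∘ₗ e.symm.toLinearMap
  let v := e.toLinearMap ∘ₗ f.rangeRestrict
  have huv : u ∘ₗ v = f := by
    refine LinearMap.ext fun x => ?_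
    simp [u, v]
  have hvu : v ∘ₗ u = LinearMap.id := by
    refine LinearMap.ext fun x => ?_
    have : f.rangeRestrict (e.symm x : Fin k → ℝ) = e.symm x := by
      obtain ⟨z, hz⟩ := (e.symm x).2
      refine Subtype.ext ?_
      rw [← hz]
      exact hff z
    simp [u, v, this]
  have h1 : LinearMap.toMatrix' u * LinearMap.toMatrix' v = X := by
    rw [← LinearMap.toMatrix'_comp, huv, hf, LinearMap.toMatrix'_toLin']
  have h2 : LinearMap.toMatrix' v * LinearMap.toMatrix' u = 1 := by
    rw [← LinearMap.toMatrix'_comp, hvu, LinearMap.toMatrix'_id]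
  refine ⟨_, LinearMap.toMatrix' u, LinearMap.toMatrix' v, h1, h2, ?_⟩
  rw [← h1, Matrix.trace_mul_comm, h2]
  simp

end Idempotent

section SphereBundle

/-- The coordinates of `(X, y, t)` with `X` a `k × k` matrix, `y` a vector and `t` a scalar. -/
abbrev BundleCoord (k : ℕ) := (Fin k × Fin k) ⊕ (Fin k ⊕ Unit)

/-- The indices of the equations `X = Xᵀ`, `X² = X`, `X y = y` and `|y|² + t² = t`. -/
abbrev BundleEqIndex (k : ℕ) := (Fin k × Fin k) ⊕ ((Fin k × Fin k) ⊕ (Fin k ⊕ Unit))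

variable {k : ℕ}

/-- The matrix component of a point `(X, y, t)`. -/
def bundleMat (z : BundleCoord k → ℝ) : Matrix (Fin k) (Fin k) ℝ := matOf fun p => z (Sum.inl p)

/-- The vector component of a point `(X, y, t)`. -/
def bundleVec (z : BundleCoord k → ℝ) : Fin k → ℝ := fun i => z (Sum.inr (Sum.inl i))

/-- The scalar component of a point `(X, y, t)`. -/
def bundleScalar (z : BundleCoord k → ℝ) : ℝ := z (Sum.inr (Sum.inr ()))

/-- The point with components `X`, `y`, `t`. -/
def bundlePoint (X : Matrix (Fin k) (Fin k) ℝ) (y : Fin k → ℝ) (t : ℝ) : BundleCoord k → ℝ :=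
  Sum.elim (fun p => X p.1 p.2) (Sum.elim y fun _ => t)

@[simp] lemma bundleMat_point (X : Matrix (Fin k) (Fin k) ℝ) (y : Fin k → ℝ) (t : ℝ) :
    bundleMat (bundlePoint X y t) = X := rfl

@[simp] lemma bundleVec_point (X : Matrix (Fin k) (Fin k) ℝ) (y : Fin k → ℝ) (t : ℝ) :
    bundleVec (bundlePoint X y t) = y := rfl

@[simp] lemma bundleScalar_point (X : Matrix (Fin k) (Fin k) ℝ) (y : Fin k → ℝ) (t : ℝ) :
    bundleScalar (bundlePoint X y t) = t := rfl

lemma bundlePoint_eta (z : BundleCoord k → ℝ) :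
    bundlePoint (bundleMat z) (bundleVec z) (bundleScalar z) = z := by
  ext i
  rcases i with p | i | i <;> rfl

/-- The polynomial equations of the sphere bundle over all Grassmannians of `ℝ^k`. -/
noncomputable def bundleEq (k : ℕ) : BundleEqIndex k → MvPolynomial (BundleCoord k) ℚ :=
  Sum.elim (fun p => X (Sum.inl (p.1, p.2)) - X (Sum.inl (p.2, p.1))) <|
  Sum.elim (fun p => (∑ l, X (Sum.inl (p.1, l)) * X (Sum.inl (l, p.2))) -
    X (Sum.inl (p.1, p.2))) <|
  Sum.elim (fun i => (∑ l, X (Sum.inl (i, l)) * X (Sum.inr (Sum.inl l))) -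
    X (Sum.inr (Sum.inl i)))
  fun _ => (∑ i, X (Sum.inr (Sum.inl i)) * X (Sum.inr (Sum.inl i))) +
    X (Sum.inr (Sum.inr ())) * X (Sum.inr (Sum.inr ())) - X (Sum.inr (Sum.inr ()))

/-- The trace of the matrix component, as a polynomial. -/
noncomputable def bundleTrace (k : ℕ) : MvPolynomial (BundleCoord k) ℚ :=
  ∑ i, X (Sum.inl (i, i))

/-- A family of values indexed by the equations, given by components. -/
def eqPoint (A B : Matrix (Fin k) (Fin k) ℝ) (c : Fin k → ℝ) (d : ℝ) : BundleEqIndex k → ℝ :=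
  Sum.elim (fun p => A p.1 p.2) (Sum.elim (fun p => B p.1 p.2) (Sum.elim c fun _ => d))

lemma eqPoint_inj {A B A' B' : Matrix (Fin k) (Fin k) ℝ} {c c' : Fin k → ℝ} {d d' : ℝ} :
    eqPoint A B c d = eqPoint A' B' c' d' ↔ A = A' ∧ B = B' ∧ c = c' ∧ d = d' := by
  constructor
  · intro h
    exact ⟨Matrix.ext fun i j => congrFun h (Sum.inl (i, j)),
      Matrix.ext fun i j => congrFun h (Sum.inr (Sum.inl (i, j))),
      funext fun i => congrFun h (Sum.inr (Sum.inr (Sum.inl i))),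
      congrFun h (Sum.inr (Sum.inr (Sum.inr ())))⟩
  · rintro ⟨rfl, rfl, rfl, rfl⟩
    rfl

lemma exists_eqPoint (w : BundleEqIndex k → ℝ) : ∃ A B c d, w = eqPoint A B c d :=
  ⟨Matrix.of fun i j => w (Sum.inl (i, j)), Matrix.of fun i j => w (Sum.inr (Sum.inl (i, j))),
    fun i => w (Sum.inr (Sum.inr (Sum.inl i))), w (Sum.inr (Sum.inr (Sum.inr ()))), by
      ext i
      rcases i with p | p | i | i <;> rfl⟩

lemma eqPoint_zero : (eqPoint 0 0 0 0 : BundleEqIndex k → ℝ) = 0 := by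
  ext i
  rcases i with p | p | i | i <;> rfl

lemma aeval_bundleEq (z : BundleCoord k → ℝ) :
    (fun j => aeval z (bundleEq k j)) =
      eqPoint (bundleMat z - (bundleMat z).transpose) (bundleMat z * bundleMat z - bundleMat z)
        ((bundleMat z).mulVec (bundleVec z) - bundleVec z)
        (bundleVec z ⬝ᵥ bundleVec z + bundleScalar z * bundleScalar z - bundleScalar z) := by
  ext i
  rcases i with p | p | i | i <;>
  simp [bundleEq, eqPoint, bundleMat, bundleVec, bundleScalar, matOf, Matrix.mul_apply,
    Matrix.mulVec, dotProduct]

lemma dirDerivQ_bundleEq (a h : BundleCoord k → ℝ) :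
    (fun j => dirDerivQ a h (bundleEq k j)) =
      eqPoint (bundleMat h - (bundleMat h).transpose)
        (bundleMat a * bundleMat h + bundleMat h * bundleMat a - bundleMat h)
        ((bundleMat h).mulVec (bundleVec a) + (bundleMat a).mulVec (bundleVec h) - bundleVec h)
        (2 * (bundleVec a ⬝ᵥ bundleVec h) + (2 * bundleScalar a - 1) * bundleScalar h) := by
  ext i
  rcases i with p | p | i | i <;>
  simp [bundleEq, eqPoint, bundleMat, bundleVec, bundleScalar, matOf, Matrix.mul_apply,
    Matrix.mulVec, dotProduct, Finset.sum_add_distrib, mul_comm] <;> ring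

lemma aeval_bundleTrace (z : BundleCoord k → ℝ) :
    aeval z (bundleTrace k) = (bundleMat z).trace := by
  simp [bundleTrace, bundleMat, matOf, Matrix.trace]

lemma forall_aeval_bundleEq (z : BundleCoord k → ℝ) :
    (∀ j, aeval z (bundleEq k j) = 0) ↔
      (bundleMat z).transpose = bundleMat z ∧ bundleMat z * bundleMat z = bundleMat z ∧
      (bundleMat z).mulVec (bundleVec z) = bundleVec z ∧
      bundleVec z ⬝ᵥ bundleVec z + bundleScalar z * bundleScalar z = bundleScalar z := by
  have h := aeval_bundleEq z
  have h2 : (∀ j, aeval z (bundleEq k j) = 0) ↔ (fun j => aeval z (bundleEq k j)) = 0 :=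
    funext_iff.symm
  rw [h2, h, ← eqPoint_zero, eqPoint_inj, sub_eq_zero, sub_eq_zero, sub_eq_zero, sub_eq_zero,
    eq_comm (a := bundleMat z)]

lemma mem_univSphereBundle {m n : ℕ} (z : BundleCoord (m + n) → ℝ) :
    z ∈ UnivSphereBundle m n ↔
      (∀ j, aeval z (bundleEq (m + n) j) = 0) ∧ (bundleMat z).trace = m := by
  rw [forall_aeval_bundleEq]
  simp only [UnivSphereBundle, Grass, GrassMatrix, Set.mem_ofPred_eq, dotProduct, ← pow_two]
  simp only [bundleMat, bundleVec, bundleScalar]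
  tauto

/-- The linear relations satisfied by the values of the equations at `(X, y, t)`. -/
def bundleRelation (z : BundleCoord k → ℝ) :
    (BundleEqIndex k → ℝ) →ₗ[ℝ]
      (Fin k × Fin k → ℝ) × (Fin k × Fin k → ℝ) × (Fin k × Fin k → ℝ) × (Fin k → ℝ) where
  toFun w :=
    let X := bundleMat z
    let A : Matrix (Fin k) (Fin k) ℝ := Matrix.of fun i j => w (Sum.inl (i, j))
    let B : Matrix (Fin k) (Fin k) ℝ := Matrix.of fun i j => w (Sum.inr (Sum.inl (i, j)))
    let c : Fin k → ℝ := fun i => w (Sum.inr (Sum.inr (Sum.inl i)))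
    (fun p => (A + A.transpose) p.1 p.2,
      fun p => (X * B - B * X) p.1 p.2,
      fun p => (B - B.transpose - (X * A + A * X.transpose - A)) p.1 p.2,
      X.mulVec c - B.mulVec (bundleVec z))
  map_add' w w' := by
    refine Prod.ext ?_ (Prod.ext ?_ (Prod.ext ?_ ?_)) <;> ext i <;>
    simp [Matrix.mul_apply, Matrix.mulVec, dotProduct, mul_add, add_mul,
      Finset.sum_add_distrib] <;> ring
  map_smul' r w := by
    refine Prod.ext ?_ (Prod.ext ?_ (Prod.ext ?_ ?_)) <;> ext i <;>
    simp [Matrix.mul_apply, Matrix.mulVec, dotProduct, mul_add, mul_sub, Finset.mul_sum,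
      mul_assoc, mul_left_comm]

lemma bundleRelation_eqPoint (z : BundleCoord k → ℝ) (A B : Matrix (Fin k) (Fin k) ℝ)
    (c : Fin k → ℝ) (d : ℝ) :
    bundleRelation z (eqPoint A B c d) = 0 ↔
      A + A.transpose = 0 ∧ bundleMat z * B = B * bundleMat z ∧
      B - B.transpose = bundleMat z * A + A * (bundleMat z).transpose - A ∧
      (bundleMat z).mulVec c = B.mulVec (bundleVec z) := by
  rw [← sub_eq_zero (a := bundleMat z * B), ← sub_eq_zero (a := B - B.transpose),
    ← sub_eq_zero (a := (bundleMat z).mulVec c)]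
  constructor
  · intro h
    simp only [Prod.ext_iff] at h
    obtain ⟨h1, h2, h3, h4⟩ := h
    exact ⟨Matrix.ext fun i j => congrFun h1 (i, j), Matrix.ext fun i j => congrFun h2 (i, j),
      Matrix.ext fun i j => congrFun h3 (i, j), h4⟩
  · rintro ⟨h1, h2, h3, h4⟩
    exact Prod.ext (funext fun p => congrFun₂ h1 p.1 p.2) (Prod.ext
      (funext fun p => congrFun₂ h2 p.1 p.2) (Prod.ext
      (funext fun p => congrFun₂ h3 p.1 p.2) h4))

lemma bundleRelation_aeval (z : BundleCoord k → ℝ) :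
    bundleRelation z (fun j => aeval z (bundleEq k j)) = 0 := by
  rw [aeval_bundleEq, bundleRelation_eqPoint]
  refine ⟨?_, ?_, ?_, ?_⟩
  · rw [Matrix.transpose_sub, Matrix.transpose_transpose]
    abel
  · noncomm_ring
  · rw [Matrix.transpose_sub, Matrix.transpose_mul]
    noncomm_ring
  · rw [Matrix.mulVec_sub, Matrix.sub_mulVec, Matrix.mulVec_mulVec]

lemma continuous_bundleRelation (w : BundleEqIndex k → ℝ) :
    Continuous fun z : BundleCoord k → ℝ => bundleRelation z w := by
  have hX : Continuous fun z : BundleCoord k → ℝ => bundleMat z :=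
    continuous_matrix fun i j => continuous_apply _
  have hy : Continuous fun z : BundleCoord k → ℝ => bundleVec z :=
    continuous_pi fun i => continuous_apply _
  simp only [bundleRelation, LinearMap.coe_mk, AddHom.coe_mk]
  refine continuous_const.prodMk ((continuous_pi fun p => ?_).prodMk
    ((continuous_pi fun p => ?_).prodMk ?_))
  · exact Continuous.matrix_elem (by fun_prop) _ _
  · exact Continuous.matrix_elem (by fun_prop) _ _
  · exact (hX.matrix_mulVec continuous_const).sub (continuous_const.matrix_mulVec hy)

lemma bundleRelation_exact {a : BundleCoord k → ℝ} (ha : ∀ j, aeval a (bundleEq k j) = 0)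
    {w : BundleEqIndex k → ℝ} (hw : bundleRelation a w = 0) :
    ∃ h, ∀ j, dirDerivQ a h (bundleEq k j) = w j := by
  obtain ⟨A, B, c, d, rfl⟩ := exists_eqPoint w
  rw [bundleRelation_eqPoint] at hw
  rw [forall_aeval_bundleEq] at ha
  obtain ⟨hsym, hidem, hy, ht⟩ := ha
  obtain ⟨hA, hXB, hB, hc⟩ := hw
  suffices h : ∃ h, (fun j => dirDerivQ a h (bundleEq k j)) = eqPoint A B c d from
    h.imp fun h hh => congrFun hh
  simp only [dirDerivQ_bundleEq, eqPoint_inj]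
  set X := bundleMat a
  set y := bundleVec a
  set t := bundleScalar a
  rw [hsym] at hB
  have hAt : A.transpose = -A := (neg_eq_of_add_eq_zero_right hA).symm
  have hBt : B.transpose = B - (X * A + A * X - A) := by rw [← hB]; abel
  have hXX (M : Matrix (Fin k) (Fin k) ℝ) : X * (X * M) = X * M := by
    rw [← mul_assoc, hidem]
  have hdot (v : Fin k → ℝ) : y ⬝ᵥ X.mulVec v = y ⬝ᵥ v := by
    rw [Matrix.dotProduct_mulVec, ← Matrix.mulVec_transpose, hsym, hy]
  refine ⟨bundlePoint (X * B + X * B - B + X * A - X * (A * X))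
    ((2 * d) • y - (c - X.mulVec c)) ((2 * t - 1) * d), ?_, ?_, ?_, ?_⟩
  · simp only [bundleMat_point, Matrix.transpose_sub, Matrix.transpose_add, Matrix.transpose_mul,
      hsym, hAt, hBt, add_mul, sub_mul, mul_assoc, hidem, ← hXB, neg_mul, mul_neg]
    abel
  · simp only [bundleMat_point, mul_add, mul_sub, add_mul, sub_mul, mul_assoc, hXX, hidem, ← hXB]
    abel
  · simp only [bundleMat_point, bundleVec_point, Matrix.sub_mulVec, Matrix.add_mulVec,
      Matrix.mulVec_sub, Matrix.mulVec_smul, ← Matrix.mulVec_mulVec, hy, ← hc]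
    simp only [Matrix.mulVec_mulVec, hidem]
    abel
  · simp only [bundleVec_point, bundleScalar_point, dotProduct_sub, hdot, dotProduct_smul,
      smul_eq_mul]
    linear_combination (4 * d) * ht

/-- A parametrization of the tangent space at `(X, y, t)` (with the sphere condition dropped),
given a rank factorization `X = U * V` and a map `V'` onto a complement. -/
def bundleTangentParam {m n : ℕ} (U : Matrix (Fin k) (Fin m) ℝ) (V' : Matrix (Fin n) (Fin k) ℝ)
    (y : Fin k → ℝ) :
    (Matrix (Fin m) (Fin n) ℝ × (Fin m → ℝ) × ℝ) →ₗ[ℝ] (BundleCoord k → ℝ) where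
  toFun p := bundlePoint (U * p.1 * V' + (U * p.1 * V').transpose)
    ((U * p.1 * V' + (U * p.1 * V').transpose).mulVec y + U.mulVec p.2.1) p.2.2
  map_add' p q := by
    ext i
    rcases i with i | i | i <;>
    simp [bundlePoint, Matrix.mul_add, Matrix.add_mul, Matrix.add_mulVec, Matrix.mulVec_add] <;>
    ring
  map_smul' r p := by
    ext i
    rcases i with i | i | i <;>
    simp [bundlePoint, Matrix.add_mulVec, Matrix.mulVec_smul, ← smul_add, Matrix.smul_mulVec,
      mul_add]

/-- The tangent space at `a` defined by the equations of the sphere bundle. -/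
def bundleTangent (a : BundleCoord k → ℝ) : Submodule ℝ (BundleCoord k → ℝ) where
  carrier := {h | ∀ j, dirDerivQ a h (bundleEq k j) = 0}
  zero_mem' j := dotProduct_zero _
  add_mem' {h h'} hh hh' j := by
    rw [dirDerivQ, dotProduct_add, ← dirDerivQ, ← dirDerivQ, hh j, hh' j, add_zero]
  smul_mem' r h hh j := by
    rw [dirDerivQ, dotProduct_smul, ← dirDerivQ, hh j, smul_zero]

lemma mem_bundleTangent {a h : BundleCoord k → ℝ} : h ∈ bundleTangent a ↔
    bundleMat h = (bundleMat h).transpose ∧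
    bundleMat a * bundleMat h + bundleMat h * bundleMat a = bundleMat h ∧
    (bundleMat h).mulVec (bundleVec a) + (bundleMat a).mulVec (bundleVec h) = bundleVec h ∧
    2 * (bundleVec a ⬝ᵥ bundleVec h) + (2 * bundleScalar a - 1) * bundleScalar h = 0 := by
  have h2 : h ∈ bundleTangent a ↔ (fun j => dirDerivQ a h (bundleEq k j)) = 0 :=
    funext_iff.symm
  rw [h2, dirDerivQ_bundleEq, ← eqPoint_zero, eqPoint_inj, sub_eq_zero, sub_eq_zero, sub_eq_zero]

lemma finrank_bundleTangent {m n : ℕ} {a : BundleCoord (m + n) → ℝ}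
    (ha : a ∈ UnivSphereBundle m n) : Module.finrank ℝ (bundleTangent a) = m * (n + 1) := by
  rw [mem_univSphereBundle, forall_aeval_bundleEq] at ha
  obtain ⟨⟨hsym, hidem, hy, ht⟩, htr⟩ := ha
  have hidem' : (1 - bundleMat a) * (1 - bundleMat a) = 1 - bundleMat a := by
    simp only [sub_mul, mul_sub, hidem]
    simp
  obtain ⟨r, U, V, hUV, hVU, hr⟩ := exists_factorization_of_isIdempotent hidem
  obtain ⟨r', U', V', hUV', hVU', hr'⟩ := exists_factorization_of_isIdempotent hidem'
  obtain rfl : r = m := by exact_mod_cast hr.symm.trans htr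
  obtain rfl : r' = n := by
    rw [Matrix.trace_sub, htr, Matrix.trace_one, Fintype.card_fin] at hr'
    push_cast at hr'
    have : (r' : ℝ) = n := by linarith
    exact_mod_cast this
  set X := bundleMat a
  set y := bundleVec a
  set t := bundleScalar a
  have hXU : X * U = U := by rw [← hUV, Matrix.mul_assoc, hVU, Matrix.mul_one]
  have hV'X : V' * X = 0 := by
    have h1 : V' * (1 - X) = V' := by rw [← hUV', ← Matrix.mul_assoc, hVU', Matrix.one_mul]
    rw [Matrix.mul_sub, Matrix.mul_one] at h1
    exact sub_eq_self.mp h1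
  have hXN (K : Matrix (Fin r) (Fin r') ℝ) : X * (U * K * V') = U * K * V' := by
    rw [← Matrix.mul_assoc, ← Matrix.mul_assoc, hXU]
  have hNX (K : Matrix (Fin r) (Fin r') ℝ) : (U * K * V') * X = 0 := by
    rw [Matrix.mul_assoc, hV'X, Matrix.mul_zero]
  have hXNt (K : Matrix (Fin r) (Fin r') ℝ) : X * (U * K * V').transpose = 0 := by
    have := congrArg Matrix.transpose (hNX K)
    rwa [Matrix.transpose_mul, hsym, Matrix.transpose_zero] at this
  have hNtX (K : Matrix (Fin r) (Fin r') ℝ) :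
      (U * K * V').transpose * X = (U * K * V').transpose := by
    have := congrArg Matrix.transpose (hXN K)
    rwa [Matrix.transpose_mul, hsym] at this
  set Θ := bundleTangentParam U V' y with hΘ
  have hΘinj : Function.Injective Θ := by
    rw [← LinearMap.ker_eq_bot, LinearMap.ker_eq_bot']
    rintro ⟨K, v, τ⟩ h0
    have hM : U * K * V' + (U * K * V').transpose = 0 := congrArg bundleMat h0
    have hv : (U * K * V' + (U * K * V').transpose).mulVec y + U.mulVec v = 0 :=
      congrArg bundleVec h0
    have hτ : τ = 0 := congrArg bundleScalar h0
    have hN : U * K * V' = 0 := by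
      have := congrArg (X * ·) hM
      simpa only [Matrix.mul_add, hXN, hXNt, add_zero, Matrix.mul_zero] using this
    have hK : K = 0 := by
      have : V * (U * K * V') * U' = K := by
        rw [Matrix.mul_assoc U, ← Matrix.mul_assoc V, hVU, Matrix.one_mul, Matrix.mul_assoc,
          hVU', Matrix.mul_one]
      rw [← this, hN, Matrix.mul_zero, Matrix.zero_mul]
    have hv0 : v = 0 := by
      rw [hM, Matrix.zero_mulVec, zero_add] at hv
      have := congrArg V.mulVec hv
      rwa [Matrix.mulVec_mulVec, hVU, Matrix.one_mulVec, Matrix.mulVec_zero] at this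
    rw [hK, hv0, hτ]
    rfl
  let φ : (BundleCoord (r + r') → ℝ) →ₗ[ℝ] ℝ :=
    { toFun := fun h => 2 * (y ⬝ᵥ bundleVec h) + (2 * t - 1) * bundleScalar h
      map_add' := fun h h' => by
        have h1 : bundleVec (h + h') = bundleVec h + bundleVec h' := rfl
        have h2 : bundleScalar (h + h') = bundleScalar h + bundleScalar h' := rfl
        rw [h1, h2, dotProduct_add]
        ring
      map_smul' := fun s h => by
        have h1 : bundleVec (s • h) = s • bundleVec h := rfl
        have h2 : bundleScalar (s • h) = s * bundleScalar h := rfl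
        rw [h1, h2, dotProduct_smul]
        simp only [smul_eq_mul, RingHom.id_apply]
        ring }
  have hφ (h) : φ h = 2 * (y ⬝ᵥ bundleVec h) + (2 * t - 1) * bundleScalar h := rfl
  have hψ : φ ∘ₗ Θ ≠ 0 := by
    intro h0
    have h1 : φ (Θ (0, (2 : ℝ) • V.mulVec y, 2 * t - 1)) = 0 := LinearMap.congr_fun h0 _
    have h2 : bundleVec (Θ (0, (2 : ℝ) • V.mulVec y, 2 * t - 1)) = (2 : ℝ) • y := by
      simp [hΘ, bundleTangentParam, Matrix.mulVec_smul, Matrix.mulVec_mulVec, hUV, hy]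
    have h3 : bundleScalar (Θ (0, (2 : ℝ) • V.mulVec y, 2 * t - 1)) = 2 * t - 1 := rfl
    rw [hφ, h2, h3, dotProduct_smul, smul_eq_mul] at h1
    nlinarith
  have hmap : (LinearMap.ker (φ ∘ₗ Θ)).map Θ = bundleTangent a := by
    ext h
    rw [Submodule.mem_map, mem_bundleTangent]
    constructor
    · rintro ⟨⟨K, v, τ⟩, hker, rfl⟩
      refine ⟨?_, ?_, ?_, hker⟩
      · simp only [hΘ, bundleTangentParam, LinearMap.coe_mk, AddHom.coe_mk, bundleMat_point,
          Matrix.transpose_add, Matrix.transpose_transpose]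
        abel
      · simp only [hΘ, bundleTangentParam, LinearMap.coe_mk, AddHom.coe_mk, bundleMat_point]
        rw [Matrix.mul_add, Matrix.add_mul, hXN, hXNt, hNX, hNtX, add_zero, zero_add]
      · have h1 : (U * K * V').mulVec y = 0 := by
          rw [← hy, Matrix.mulVec_mulVec, hNX, Matrix.zero_mulVec]
        simp only [hΘ, bundleTangentParam, LinearMap.coe_mk, AddHom.coe_mk, bundleMat_point,
          bundleVec_point]
        rw [Matrix.mulVec_add, Matrix.mulVec_mulVec, Matrix.mulVec_mulVec, Matrix.mul_add, hXN,
          hXNt, hXU, add_zero, h1, zero_add]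
    · rintro ⟨h1, h2, h3, h4⟩
      set H := bundleMat h
      set η := bundleVec h
      have hXHX : X * H * X = 0 := by
        have := congrArg (X * ·) (show X * H + H * X = H from h2)
        simp only [Matrix.mul_add, ← Matrix.mul_assoc, hidem] at this
        exact left_eq_add.mp this.symm
      have hN : U * (V * H * U') * V' = X * H := by
        have : U * (V * H * U') * V' = U * V * H * (U' * V') := by
          simp only [Matrix.mul_assoc]
        rw [this, hUV, hUV', Matrix.mul_sub, Matrix.mul_one, hXHX, sub_zero]
      have hΘh : Θ (V * H * U', V.mulVec η, bundleScalar h) = h := by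
        simp only [hΘ, bundleTangentParam, LinearMap.coe_mk, AddHom.coe_mk]
        rw [hN, Matrix.transpose_mul, hsym, ← h1, h2, Matrix.mulVec_mulVec, hUV, h3]
        exact bundlePoint_eta h
      refine ⟨_, ?_, hΘh⟩
      rw [LinearMap.mem_ker, LinearMap.comp_apply, hΘh, hφ]
      exact h4
  rw [← hmap, ← (Submodule.equivMapOfInjective Θ hΘinj _).finrank_eq]
  have := Module.Dual.finrank_ker_add_one_of_ne_zero (f := φ ∘ₗ Θ) hψ
  simp only [Module.finrank_prod, Module.finrank_matrix, Module.finrank_fintype_fun_eq_card,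
    Fintype.card_fin, Module.finrank_self, mul_one] at this
  rw [mul_add, mul_one]
  omega

lemma isProjQClosed_univSphereBundle (m n : ℕ) : IsProjQClosed (UnivSphereBundle m n) := by
  set S : MvPolynomial (BundleCoord (m + n)) ℚ := ∑ i, X i * X i with hS
  set T : MvPolynomial (BundleCoord (m + n)) ℚ := X (Sum.inr (Sum.inr ())) + C (m : ℚ) with hTdef
  have hSh : S.IsHomogeneous 2 :=
    IsHomogeneous.sum _ _ _ fun i _ => (isHomogeneous_X ℚ i).mul (isHomogeneous_X ℚ i)
  have hX (i : BundleCoord (m + n)) : (X i : MvPolynomial _ ℚ).totalDegree ≤ 3 := by simp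
  have hXX (i j : BundleCoord (m + n)) : (X i * X j : MvPolynomial _ ℚ).totalDegree ≤ 3 :=
    (totalDegree_mul _ _).trans (by simp)
  have hT : T.totalDegree ≤ 1 := by
    refine (totalDegree_add _ _).trans (max_le (by simp) ?_)
    rw [totalDegree_C]
    exact zero_le_one
  refine isProjQClosed_of_definite_relation (k := 4)
    (g := Sum.elim (bundleEq (m + n)) fun _ : Unit => bundleTrace (m + n) - C (m : ℚ))
    ?_ (S * S) (-(T * T)) (hSh.mul hSh) ?_ ?_ ?_ ?_
  · ext z
    rw [mem_univSphereBundle]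
    simp [aeval_bundleTrace, sub_eq_zero]
  · intro x hx
    rw [map_mul, mul_self_eq_zero, hS, map_sum] at hx
    simp only [map_mul, aeval_X] at hx
    ext i
    exact mul_self_eq_zero.mp
      ((Finset.sum_eq_zero_iff_of_nonneg fun i _ => mul_self_nonneg _).mp hx i
        (Finset.mem_univ i))
  · rw [totalDegree_neg]
    exact (totalDegree_mul _ _).trans_lt (by omega)
  · intro j
    refine Nat.lt_succ_of_le ?_
    rcases j with (p | p | i | i) | i
    · exact (totalDegree_sub _ _).trans (max_le (hX _) (hX _))
    · exact (totalDegree_sub _ _).trans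
        (max_le (totalDegree_finsetSum_le fun _ _ => hXX _ _) (hX _))
    · exact (totalDegree_sub _ _).trans
        (max_le (totalDegree_finsetSum_le fun _ _ => hXX _ _) (hX _))
    · exact (totalDegree_sub _ _).trans (max_le ((totalDegree_add _ _).trans
        (max_le (totalDegree_finsetSum_le fun _ _ => hXX _ _) (hXX _ _))) (hX _))
    · exact (totalDegree_sub _ _).trans
        (max_le (totalDegree_finsetSum_le fun _ _ => hX _) ((totalDegree_C _).trans_le zero_le))
  · intro z hz
    rw [mem_univSphereBundle, forall_aeval_bundleEq] at hz
    obtain ⟨⟨hsym, hidem, -, ht⟩, htr⟩ := hz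
    have hfrob : ∑ p : Fin (m + n) × Fin (m + n), z (Sum.inl p) * z (Sum.inl p) = m := by
      rw [← htr, ← hidem, Fintype.sum_prod_type]
      nth_rewrite 2 [← hsym]
      simp [Matrix.trace, Matrix.mul_apply, bundleMat, matOf]
    have hSz : aeval z S = m + z (Sum.inr (Sum.inr ())) := by
      simp only [hS, map_add, map_sum, map_mul, aeval_X, Fintype.sum_sum_type, hfrob]
      rw [← show _ = z (Sum.inr (Sum.inr ())) from ht]
      simp [bundleVec, bundleScalar, dotProduct]
    simp only [map_add, map_neg, map_mul, hSz, hTdef, aeval_X, aeval_C]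
    simp
    ring

lemma exists_local_equations_univSphereBundle {m n : ℕ} {a : BundleCoord (m + n) → ℝ}
    (ha : a ∈ UnivSphereBundle m n) :
    ∃ q : Fin (Fintype.card (BundleCoord (m + n)) - m * (n + 1)) →
        MvPolynomial (BundleCoord (m + n)) ℚ,
      (∀ j, ∀ x ∈ UnivSphereBundle m n, aeval x (q j) = 0) ∧
      LinearIndependent ℝ (fun j => polyGradQ (q j) a) ∧
      ∃ U : Set (BundleCoord (m + n) → ℝ), IsOpen U ∧ a ∈ U ∧
        UnivSphereBundle m n ∩ U = {x ∈ U | ∀ j, aeval x (q j) = 0} := by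
  have ha' := (mem_univSphereBundle a).mp ha
  obtain ⟨s, hs, U, hU, haU, hzero⟩ := exists_independent_equations (bundleEq (m + n))
    (bundleTangent a) (fun h => Iff.rfl) (finrank_bundleTangent ha) bundleRelation
    continuous_bundleRelation bundleRelation_aeval fun w => bundleRelation_exact ha'.1
  have htr : Continuous fun x : BundleCoord (m + n) → ℝ => aeval x (bundleTrace (m + n)) :=
    (contDiff_aeval_mvPolynomial _ 0).continuous
  refine ⟨fun j => bundleEq (m + n) (s j),
    fun j x hx => ((mem_univSphereBundle x).mp hx).1 (s j), hs,
    U ∩ {x | aeval x (bundleTrace (m + n)) ∈ Metric.ball (m : ℝ) 1},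
    hU.inter (Metric.isOpen_ball.preimage htr), ⟨haU, ?_⟩, ?_⟩
  · change aeval a (bundleTrace (m + n)) ∈ Metric.ball (m : ℝ) 1
    rw [aeval_bundleTrace, ha'.2]
    exact Metric.mem_ball_self one_pos
  · ext x
    constructor
    · rintro ⟨hx, hxU⟩
      exact ⟨hxU, fun j => ((mem_univSphereBundle x).mp hx).1 (s j)⟩
    · rintro ⟨hxU, hx⟩
      have hall := hzero x hxU.1 hx
      refine ⟨(mem_univSphereBundle x).mpr ⟨hall, ?_⟩, hxU⟩
      obtain ⟨r, -, -, -, -, hr⟩ :=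
        exists_factorization_of_isIdempotent ((forall_aeval_bundleEq x).mp hall).2.1
      have hball : aeval x (bundleTrace (m + n)) ∈ Metric.ball (m : ℝ) 1 := hxU.2
      rw [aeval_bundleTrace, hr, Metric.mem_ball, Real.dist_eq, abs_lt] at hball
      have h1 : r < m + 1 := by exact_mod_cast (by linarith [hball.2] : (r : ℝ) < m + 1)
      have h2 : m < r + 1 := by exact_mod_cast (by linarith [hball.1] : (m : ℝ) < r + 1)
      rw [hr, show r = m by omega]

end SphereBundle

/-- **The universal sphere bundle is a projectively `ℚ`-closed `ℚ`-nonsingular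
`ℚ`-algebraic set of dimension `m(n+1)`.** -/
theorem univSphereBundle_isProjQClosed_isQNonsingular (m n : ℕ) :
    IsProjQClosed (UnivSphereBundle m n) ∧
    IsQNonsingular (m * (n + 1)) (UnivSphereBundle m n) := by
  have hproj := isProjQClosed_univSphereBundle m n
  refine ⟨hproj, ?_, ?_, fun a ha => exists_local_equations_univSphereBundle ha⟩
  · obtain ⟨p, -, hp⟩ := hproj
    exact ⟨{p}, by simpa using hp⟩
  · refine isSmoothSubmanifold_of_polynomials fun a ha => ?_
    obtain ⟨q, -, hq⟩ := exists_local_equations_univSphereBundle ha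
    exact ⟨q, hq⟩
end

section
/- ℚ-nonsingularity of embedded Bott–Samelson sets: Let λ be a partition of the m×n rectangle with λ_m = 0 and λ_1 < n. Then the embedded Bott–Samelson set Z_λ is a projectively ℚ-closed ℚ-nonsingular ℚ-algebraic subset of ℝ^{(m+n)²·c} of dimension mn − |λ|. -/
open MvPolynomial

section RationalZeroSets

variable {ι : Type*}

/-- A power of `S - M`, with `S` quadratic and `M` constant, is `S ^ e` up to lower degree terms. -/
lemma exists_sub_C_pow_eq (S : MvPolynomial ι ℝ) (hS : S.totalDegree ≤ 2) (M : ℝ) (e : ℕ) :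
    ∃ r : MvPolynomial ι ℝ, (S - C M) ^ (e + 1) = S ^ (e + 1) + r ∧
      r.totalDegree < 2 * (e + 1) := by
  induction e with
  | zero =>
    refine ⟨-C M, by ring, ?_⟩
    rw [totalDegree_neg, totalDegree_C]
    norm_num
  | succ e ih =>
    obtain ⟨r, hr, hd⟩ := ih
    refine ⟨r * (S - C M) - C M * S ^ (e + 1), by rw [pow_succ, hr]; ring, ?_⟩
    have h1 : (S - C M).totalDegree ≤ 2 := (totalDegree_sub_C_le S M).trans hS
    have h2 := totalDegree_mul r (S - C M)
    have h3 := totalDegree_mul (C M) (S ^ (e + 1))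
    have h4 := totalDegree_pow S (e + 1)
    have h5 := totalDegree_sub (r * (S - C M)) (C M * S ^ (e + 1))
    have h6 : (e + 1) * S.totalDegree ≤ (e + 1) * 2 := Nat.mul_le_mul_left _ hS
    rw [totalDegree_C] at h3
    rcases max_cases (r * (S - C M)).totalDegree (C M * S ^ (e + 1)).totalDegree with h | h <;>
      omega

variable [Fintype ι]

lemma isHomogeneous_sum_sq : (∑ i : ι, (X i : MvPolynomial ι ℝ) ^ 2).IsHomogeneous 2 :=
  IsHomogeneous.sum _ _ _ fun i _ => by simpa using (isHomogeneous_X ℝ i).pow 2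

lemma isOvert_add_sum_sq_sub_pow (q : MvPolynomial ι ℝ) (M : ℝ) (e : ℕ)
    (he : q.totalDegree < 2 * (e + 1)) :
    IsOvert (q + ((∑ i : ι, X i ^ 2) - C M) ^ (e + 1)) := by
  intro x hx
  set S : MvPolynomial ι ℝ := ∑ i : ι, X i ^ 2 with hSdef
  have hSh : S.IsHomogeneous 2 := isHomogeneous_sum_sq
  obtain ⟨r, hr, hd⟩ := exists_sub_C_pow_eq S hSh.totalDegree_le M e
  have hpow : (S ^ (e + 1)).IsHomogeneous (2 * (e + 1)) := hSh.pow (e + 1)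
  set p := q + (S - C M) ^ (e + 1) with hp
  have hp' : p = q + r + S ^ (e + 1) := by rw [hp, hr]; ring
  have hqr : (q + r).totalDegree < 2 * (e + 1) :=
    (totalDegree_add q r).trans_lt (max_lt he hd)
  have htop : homogeneousComponent (2 * (e + 1)) p = S ^ (e + 1) := by
    rw [hp', map_add, homogeneousComponent_eq_zero _ _ hqr, zero_add,
      homogeneousComponent_eq_self hpow]
  have hle : p.totalDegree ≤ 2 * (e + 1) := by
    rw [hp']
    exact (totalDegree_add _ _).trans (max_le hqr.le hpow.totalDegree_le)
  have hev : eval x S ^ (e + 1) = 0 := by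
    rw [← map_pow]
    rcases hle.lt_or_eq with h | h
    · rw [← htop, homogeneousComponent_eq_zero _ _ h, map_zero]
    · rw [← htop, ← h, hx]
  have hS0 : ∑ i, x i ^ 2 = 0 := by
    have := pow_eq_zero_iff (Nat.succ_ne_zero e) |>.1 hev
    simpa [hSdef] using this
  funext i
  have := (Finset.sum_eq_zero_iff_of_nonneg fun i _ => sq_nonneg (x i)).1 hS0 i (Finset.mem_univ i)
  simpa using this

/-- A `ℚ`-algebraic set contained in a sphere of rational squared radius is
projectively `ℚ`-closed. -/
lemma IsQAlgebraicSet.isProjQClosed_of_sum_sq {V : Set (ι → ℝ)} (hV : IsQAlgebraicSet V)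
    (M : ℚ) (hM : ∀ x ∈ V, ∑ i, x i ^ 2 = (M : ℝ)) : IsProjQClosed V := by
  obtain ⟨s, hs⟩ := hV
  set q : MvPolynomial ι ℚ := ∑ p ∈ s, p ^ 2 with hq
  set d := (MvPolynomial.map (algebraMap ℚ ℝ) q).totalDegree with hd
  refine ⟨q + ((∑ i : ι, X i ^ 2) - C M) ^ (2 * d + 1 + 1), ?_, ?_⟩
  · have := isOvert_add_sum_sq_sub_pow (MvPolynomial.map (algebraMap ℚ ℝ) q) (M : ℝ)
      (2 * d + 1) (by omega)
    convert this using 1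
    simp
  · have heval : ∀ x : ι → ℝ, aeval x (q + ((∑ i : ι, X i ^ 2) - C M) ^ (2 * d + 1 + 1)) =
        ∑ p ∈ s, (aeval x p) ^ 2 + (∑ i, x i ^ 2 - (M : ℝ)) ^ (2 * (d + 1)) := by
      intro x
      simp [hq, mul_add]
    ext x
    rw [Set.mem_ofPred_eq, heval]
    constructor
    · intro hx
      have h0 := hM x hx
      rw [hs] at hx
      rw [h0, sub_self, zero_pow (by omega), add_zero]
      exact Finset.sum_eq_zero fun p hp => by rw [hx p hp]; norm_num
    · intro hx
      have hpos1 : 0 ≤ ∑ p ∈ s, (aeval x p) ^ 2 := Finset.sum_nonneg fun p _ => sq_nonneg _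
      have hpos2 : 0 ≤ (∑ i, x i ^ 2 - (M : ℝ)) ^ (2 * (d + 1)) := by
        rw [pow_mul]; positivity
      have h0 : ∑ p ∈ s, (aeval x p) ^ 2 = 0 := by linarith
      rw [hs]
      intro p hp
      have := (Finset.sum_eq_zero_iff_of_nonneg fun p _ => sq_nonneg (aeval x p)).1 h0 p hp
      simpa using this

lemma MvPolynomial.contDiff_aeval (p : MvPolynomial ι ℚ) :
    ContDiff ℝ (⊤ : ℕ∞) fun x : ι → ℝ => aeval x p := by
  induction p using MvPolynomial.induction_on with
  | C a => simpa using contDiff_const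
  | add p q hp hq => simpa using hp.add hq
  | mul_X p i hp => simpa using hp.mul (contDiff_apply ℝ ℝ i)

lemma hasFDerivAt_aeval [DecidableEq ι] (p : MvPolynomial ι ℚ) (x : ι → ℝ) :
    HasFDerivAt (fun x : ι → ℝ => aeval x p)
      (∑ i, polyGradQ p x i • ContinuousLinearMap.proj (R := ℝ) (φ := fun _ : ι => ℝ) i) x := by
  induction p using MvPolynomial.induction_on with
  | C a =>
    simpa [polyGradQ] using hasFDerivAt_const (𝕜 := ℝ) (algebraMap ℚ ℝ a) x
  | add p q hp hq =>
    simp only [map_add]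
    refine (hp.fun_add hq).congr_fderiv ?_
    simp [polyGradQ, add_smul, Finset.sum_add_distrib]
  | mul_X p j hp =>
    have hj : HasFDerivAt (fun x : ι → ℝ => x j)
        (ContinuousLinearMap.proj (R := ℝ) (φ := fun _ : ι => ℝ) j) x := hasFDerivAt_apply j x
    have := hp.mul hj
    simp only [map_mul, aeval_X]
    refine this.congr_fderiv ?_
    simp only [polyGradQ, Derivation.leibniz, pderiv_X, map_add, smul_eq_mul, map_mul, aeval_X,
      add_smul, Finset.sum_add_distrib, Finset.smul_sum, smul_smul]
    congr 1
    rw [Finset.sum_eq_single j] <;> simp +contextual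

/-- Rational polynomials with linearly independent gradients cut out a smooth submanifold. -/
lemma isSmoothSubmanifold_of_local_equations [DecidableEq ι] {V : Set (ι → ℝ)} {d : ℕ}
    (hV : ∀ a ∈ V, ∃ q : Fin (Fintype.card ι - d) → MvPolynomial ι ℚ,
      (∀ j, ∀ x ∈ V, aeval x (q j) = 0) ∧
      LinearIndependent ℝ (fun j => polyGradQ (q j) a) ∧
      ∃ U : Set (ι → ℝ), IsOpen U ∧ a ∈ U ∧
        V ∩ U = {x ∈ U | ∀ j, aeval x (q j) = 0}) :
    IsSmoothSubmanifold d V := by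
  intro a ha
  obtain ⟨q, -, hli, U, hU, haU, hVU⟩ := hV a ha
  have hcont : Continuous fun x : ι → ℝ => fun j => polyGradQ (q j) x :=
    continuous_pi fun j => continuous_pi fun i => (MvPolynomial.contDiff_aeval _).continuous
  obtain ⟨W, hW, hWo, haW⟩ := eventually_nhds_iff.1 (hcont.continuousAt.eventually hli.eventually)
  refine ⟨U ∩ W, fun x j => aeval x (q j), hU.inter hWo, ⟨haU, haW⟩, ?_, ?_, ?_⟩
  · exact (contDiff_pi.2 fun j => MvPolynomial.contDiff_aeval (q j)).contDiffOn
  · intro x hx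
    have hd : HasFDerivAt (fun x : ι → ℝ => fun j => aeval x (q j))
        (ContinuousLinearMap.pi fun j => ∑ i, polyGradQ (q j) x i •
          ContinuousLinearMap.proj (R := ℝ) (φ := fun _ : ι => ℝ) i) x :=
      hasFDerivAt_pi.2 fun j => hasFDerivAt_aeval (q j) x
    rw [hd.fderiv]
    set G : Matrix (Fin (Fintype.card ι - d)) ι ℝ := Matrix.of fun j => polyGradQ (q j) x
    have hG : LinearIndependent ℝ G.row := hW x hx.2
    have hs : Function.Surjective G.mulVecLin :=
      LinearMap.range_eq_top.1 (Submodule.eq_top_of_finrank_eq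
        (by simpa [Matrix.rank] using hG.rank_matrix))
    intro y
    obtain ⟨v, hv⟩ := hs y
    refine ⟨v, ?_⟩
    rw [← hv]
    ext j
    simp [G, Matrix.mulVec, dotProduct]
  · rw [← Set.inter_assoc, hVU]
    ext x
    simp only [Set.mem_inter_iff, Set.mem_ofPred_eq, _root_.funext_iff,
      Pi.zero_apply]
    tauto

end RationalZeroSets

section ProjectionStep

open Matrix

variable {κ A : Type*} [Fintype κ]

/-- Entrywise equations for `M` to be an orthogonal projection below the projection `R`. -/
def projStep [CommRing A] (R M : Matrix κ κ A) : Matrix κ κ A :=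
  R * M * Mᵀ * R - M

lemma projStep_eq_zero_iff [CommRing A] {R M : Matrix κ κ A} (hRt : Rᵀ = R) (hR : R * R = R) :
    projStep R M = 0 ↔ Mᵀ = M ∧ M * M = M ∧ M * R = M := by
  constructor
  · intro h
    have hM : R * M * Mᵀ * R = M := sub_eq_zero.1 h
    have ht : Mᵀ = M := by
      conv_rhs => rw [← hM]
      conv_lhs => rw [← hM]
      simp [Matrix.transpose_mul, hRt, Matrix.mul_assoc]
    have hMR : M * R = M := by
      conv_lhs => rw [← hM]
      rw [Matrix.mul_assoc, hR, hM]
    have hRM : R * M = M := by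
      conv_lhs => rw [← hM]
      simp only [← Matrix.mul_assoc]
      rw [hR, hM]
    refine ⟨ht, ?_, hMR⟩
    rwa [ht, hRM, Matrix.mul_assoc, hMR] at hM
  · rintro ⟨ht, hM, hMR⟩
    have hRM : R * M = M := by
      have := congrArg Matrix.transpose hMR
      rwa [Matrix.transpose_mul, ht, hRt] at this
    rw [projStep, ht, hRM, hM, hMR, sub_self]

/-- The linear operator annihilating the residual `F = projStep R M`; see
`projStepSyzygy_projStep`. -/
def projStepSyzygy [CommRing A] (R M : Matrix κ κ A) : Matrix κ κ A →ₗ[A] Matrix κ κ A where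
  toFun W := R * M * Mᵀ * R * (W * (R * M * Mᵀ * R) + R * M * Mᵀ * R * Wᵀ * R
      - projStep R M * Wᵀ * R)
    - (R * W * (R * M * Mᵀ * R) + R * M * Mᵀ * R * Wᵀ - R * projStep R M * Wᵀ) * (R * M * Mᵀ * R)
  map_add' V W := by
    rw [Matrix.transpose_add]
    noncomm_ring
  map_smul' t W := by
    simp only [Matrix.transpose_smul, RingHom.id_apply, Matrix.mul_smul, Matrix.smul_mul,
      ← smul_add, ← smul_sub]

lemma projStepSyzygy_apply [CommRing A] (R M W : Matrix κ κ A) :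
    projStepSyzygy R M W = R * M * Mᵀ * R * (W * (R * M * Mᵀ * R) + R * M * Mᵀ * R * Wᵀ * R
      - projStep R M * Wᵀ * R)
    - (R * W * (R * M * Mᵀ * R) + R * M * Mᵀ * R * Wᵀ - R * projStep R M * Wᵀ) *
      (R * M * Mᵀ * R) := rfl

lemma projStepSyzygy_projStep [CommRing A] {R M : Matrix κ κ A} (hRt : Rᵀ = R) (hR : R * R = R) :
    projStepSyzygy R M (projStep R M) = 0 := by
  set F := projStep R M with hF
  set S := R * M * Mᵀ * R with hS
  have hSt : Sᵀ = S := by simp [hS, Matrix.transpose_mul, hRt, Matrix.mul_assoc]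
  have hSR : S * R = S := by rw [hS, Matrix.mul_assoc, hR]
  have hRS : R * S = S := by rw [hS]; simp only [← Matrix.mul_assoc]; rw [hR]
  have hM : M = S - F := by simp [hF, hS, projStep]
  have hFt : Mᵀ = S - Fᵀ := by rw [hM, Matrix.transpose_sub, hSt]
  have key : R * F * S + S * Fᵀ * R - R * F * Fᵀ * R = S * S - S := by
    have : S = R * (S - F) * (S - Fᵀ) * R := by rw [← hFt, ← hM]
    have h2 : R * (S - F) * (S - Fᵀ) * R =
        (R * S) * (S * R) - R * S * Fᵀ * R - R * F * (S * R) + R * F * Fᵀ * R := by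
      noncomm_ring
    rw [h2, hRS, hSR] at this
    have h3 : R * F * S + S * Fᵀ * R - R * F * Fᵀ * R =
        S * S - (S * S - S * Fᵀ * R - R * F * S + R * F * Fᵀ * R) := by abel
    rw [h3, ← this]
  have hl : S * (F * S + S * Fᵀ * R - F * Fᵀ * R) = S * (S * S - S) := by
    rw [← key]
    simp only [Matrix.mul_add, Matrix.mul_sub, ← Matrix.mul_assoc, hSR]
  have hr : (R * F * S + S * Fᵀ - R * F * Fᵀ) * S = (S * S - S) * S := by
    rw [← key]
    simp only [Matrix.add_mul, Matrix.sub_mul, Matrix.mul_assoc, hRS]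
  rw [projStepSyzygy_apply, ← hF, ← hS, hl, hr]
  noncomm_ring

lemma projStepSyzygy_injOn [CommRing A] {R M W : Matrix κ κ A} (hRt : Rᵀ = R) (hR : R * R = R)
    (hMt : Mᵀ = M) (hM : M * M = M) (hMR : M * R = M) (hW : projStepSyzygy R M W = 0) :
    (R - M) * W * M = 0 := by
  have hRM : R * M = M := by
    have := congrArg Matrix.transpose hMR
    rwa [Matrix.transpose_mul, hMt, hRt] at this
  have hF : projStep R M = 0 := (projStep_eq_zero_iff hRt hR).2 ⟨hMt, hM, hMR⟩
  have hS : R * M * Mᵀ * R = M := sub_eq_zero.1 hF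
  simp only [projStepSyzygy_apply, hF, hS, Matrix.zero_mul, Matrix.mul_zero, sub_zero] at hW
  have h1 : (R - M) * (M * (W * M + M * Wᵀ * R) - (R * W * M + M * Wᵀ) * M) * M
      = -((R - M) * W * M) := by
    have e1 : (R - M) * M = 0 := by rw [Matrix.sub_mul, hRM, hM, sub_self]
    have e2 : (R - M) * R = R - M := by rw [Matrix.sub_mul, hR, hMR]
    have : (R - M) * (M * (W * M + M * Wᵀ * R) - (R * W * M + M * Wᵀ) * M) * M =
      ((R - M) * M) * (W * M + M * Wᵀ * R) * M - ((R - M) * R) * W * (M * M * M)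
        - ((R - M) * M) * Wᵀ * M * M := by noncomm_ring
    rw [this, e1, e2, hM, hM]
    simp
  rw [hW] at h1
  simpa using h1.symm

/-- The derivative of `projStep R` at a projection `M ≤ R`. -/
def projStepDeriv [CommRing A] (R M H : Matrix κ κ A) : Matrix κ κ A :=
  R * (H * Mᵀ + M * Hᵀ) * R - H

lemma exists_projStepDeriv_eq_iff [CommRing A] {R M W : Matrix κ κ A} (hRt : Rᵀ = R)
    (hR : R * R = R) (hMt : Mᵀ = M) (hM : M * M = M) (hMR : M * R = M) :
    (∃ H, projStepDeriv R M H = W) ↔ (R - M) * W * M = 0 := by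
  have hRM : R * M = M := by
    have := congrArg Matrix.transpose hMR
    rwa [Matrix.transpose_mul, hMt, hRt] at this
  have e1 : (R - M) * M = 0 := by rw [Matrix.sub_mul, hRM, hM, sub_self]
  have e2 : (R - M) * R = R - M := by rw [Matrix.sub_mul, hR, hMR]
  constructor
  · rintro ⟨H, rfl⟩
    have : (R - M) * (R * (H * M + M * Hᵀ) * R - H) * M =
        ((R - M) * R) * H * (M * (R * M)) + ((R - M) * (R * M)) * Hᵀ * R * M
          - (R - M) * H * M := by noncomm_ring
    rw [projStepDeriv, hMt, this, e2, hRM, hM, e1]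
    simp
  · intro h
    have ht : M * Wᵀ * (R - M) = 0 := by
      have := congrArg Matrix.transpose h
      simpa [Matrix.transpose_mul, hMt, hRt, Matrix.mul_assoc] using this
    refine ⟨-W + M * W * M + M * Wᵀ * M, ?_⟩
    rw [projStepDeriv, hMt]
    simp only [Matrix.transpose_add, Matrix.transpose_neg, Matrix.transpose_mul,
      Matrix.transpose_transpose, hMt]
    have : R * ((-W + M * W * M + M * Wᵀ * M) * M + M * (-Wᵀ + M * (Wᵀ * M) + M * (W * M))) * R
          - (-W + M * W * M + M * Wᵀ * M) =
        - (R * W * (M * R)) + (R * M) * W * (M * M * R) + (R * M) * Wᵀ * (M * M * R)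
          - (R * M) * Wᵀ * R + (R * (M * M)) * Wᵀ * (M * R) + (R * (M * M)) * W * (M * R)
          + W - M * W * M - M * Wᵀ * M := by noncomm_ring
    rw [this, hM, hMR, hRM]
    have h' : R * W * M = M * W * M := by
      rw [← sub_eq_zero, ← h]; noncomm_ring
    have ht' : M * Wᵀ * R = M * Wᵀ * M := by
      rw [← sub_eq_zero, ← ht]; noncomm_ring
    rw [h', ht']
    abel

end ProjectionStep

section ProjectionStepRank

open Matrix

variable {κ : Type*} [Fintype κ] [DecidableEq κ]

lemma Matrix.trace_eq_rank_of_mul_self {M : Matrix κ κ ℝ} (hM : M * M = M) :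
    M.trace = (M.rank : ℝ) := by
  have hid : IsIdempotentElem M.toLin' := by
    rw [IsIdempotentElem, Module.End.mul_eq_comp, ← Matrix.toLin'_mul, hM]
  rw [← Matrix.trace_toLin'_eq, (LinearMap.IsIdempotentElem.isProj_range _ hid).trace]
  rfl

lemma Matrix.exists_finset_linearIndependent_rows {κ κ' : Type*} [Fintype κ] [Fintype κ']
    (G : Matrix κ κ' ℝ) :
    ∃ J : Finset κ, J.card = G.rank ∧ LinearIndependent ℝ (fun j : J => G j) ∧
      ∀ v, (∀ j ∈ J, (G *ᵥ v) j = 0) → G *ᵥ v = 0 := by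
  classical
  obtain ⟨τ, f, hf, hspan, hli⟩ := exists_linearIndependent' ℝ G.row
  have : Finite τ := Finite.of_injective f hf
  have := Fintype.ofFinite τ
  let e : τ ≃ (Finset.univ.image f : Finset κ) :=
    Equiv.ofBijective (fun t => ⟨f t, by simp⟩)
      ⟨fun s t h => hf (by simpa using h), by rintro ⟨j, hj⟩; simpa [Subtype.ext_iff] using hj⟩
  refine ⟨Finset.univ.image f, ?_, ?_, ?_⟩
  · rw [Finset.card_image_of_injective _ hf, Finset.card_univ, G.rank_eq_finrank_span_row, ← hspan,
      finrank_span_eq_card hli]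
  · exact (linearIndependent_equiv e).1 hli
  · intro v hv
    ext j
    have hle : Submodule.span ℝ (Set.range (G.row ∘ f)) ≤
        LinearMap.ker ((dotProductBilin ℝ ℝ).flip v) := by
      rw [Submodule.span_le]
      rintro _ ⟨t, rfl⟩
      exact hv (f t) (by simp)
    exact hle (hspan ▸ Submodule.subset_span ⟨j, rfl⟩)

/-- The Jacobian of `projStep R` at a projection `M ≤ R` has corank `tr M * tr (R - M)`. -/
lemma rank_projStepDeriv {R M : Matrix κ κ ℝ} (hRt : Rᵀ = R) (hR : R * R = R) (hMt : Mᵀ = M)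
    (hM : M * M = M) (hMR : M * R = M) {r s : ℕ} (hr : M.trace = r) (hs : (R - M).trace = s)
    (G : Matrix (κ × κ) (κ × κ) ℝ)
    (hG : ∀ (H : Matrix κ κ ℝ) i j,
      (G *ᵥ fun p => H p.1 p.2) (i, j) = projStepDeriv R M H i j) :
    G.rank + r * s = Fintype.card (κ × κ) := by
  have hRM : R * M = M := by
    have := congrArg Matrix.transpose hMR
    rwa [Matrix.transpose_mul, hMt, hRt] at this
  set Q := R - M with hQ
  have hQQ : Q * Q = Q := by
    rw [hQ, Matrix.sub_mul, Matrix.mul_sub, Matrix.mul_sub, hR, hM, hMR, hRM]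
    abel
  set N := Matrix.kronecker Q M with hN
  have hNmul : ∀ (W : Matrix κ κ ℝ) i j, (N *ᵥ fun p => W p.1 p.2) (i, j) = (Q * W * M) i j := by
    intro W i j
    simp only [hN, Matrix.mulVec, dotProduct, Fintype.sum_prod_type, Matrix.mul_apply,
      Matrix.kronecker, Matrix.kroneckerMap_apply, Finset.sum_mul]
    rw [Finset.sum_comm]
    refine Finset.sum_congr rfl fun l _ => Finset.sum_congr rfl fun k _ => ?_
    have : M j l = M l j := congrFun (congrFun hMt l) j
    rw [this]; ring
  have hNN : N * N = N := by
    rw [hN]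
    change Matrix.kroneckerMap _ _ _ * Matrix.kroneckerMap _ _ _ = _
    rw [← Matrix.mul_kronecker_mul, hQQ, hM]
    rfl
  have hNr : N.rank = r * s := by
    have h := Matrix.trace_eq_rank_of_mul_self hNN
    rw [hN, Matrix.kronecker, Matrix.trace_kronecker, hs, hr, mul_comm] at h
    exact_mod_cast h.symm
  have hrange : LinearMap.range G.mulVecLin = LinearMap.ker N.mulVecLin := by
    ext w
    have hw : w = fun p => (Matrix.of fun i j => w (i, j)) p.1 p.2 := rfl
    rw [LinearMap.mem_range, LinearMap.mem_ker]
    have h1 : (∃ y, G.mulVecLin y = w) ↔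
        ∃ H, projStepDeriv R M H = Matrix.of fun i j => w (i, j) := by
      constructor
      · rintro ⟨y, rfl⟩
        refine ⟨Matrix.of fun i j => y (i, j), ?_⟩
        ext i j
        rw [← hG]; rfl
      · rintro ⟨H, hH⟩
        refine ⟨fun p => H p.1 p.2, ?_⟩
        ext ⟨i, j⟩
        rw [Matrix.mulVecLin_apply, hG, hH]; rfl
    have h2 : N.mulVecLin w = 0 ↔ Q * (Matrix.of fun i j => w (i, j)) * M = 0 := by
      rw [Matrix.mulVecLin_apply]
      constructor
      · intro h
        ext i j
        rw [← hNmul]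
        exact congrFun h (i, j)
      · intro h
        ext ⟨i, j⟩
        have := hNmul (Matrix.of fun i j => w (i, j)) i j
        rw [h] at this
        exact this
    rw [h1, h2]
    exact exists_projStepDeriv_eq_iff hRt hR hMt hM hMR
  have hGr : G.rank = Module.finrank ℝ (LinearMap.ker N.mulVecLin) := by
    rw [Matrix.rank, hrange]
  have := N.mulVecLin.finrank_range_add_finrank_ker
  rw [← hGr, Module.finrank_fintype_fun_eq_card] at this
  change N.rank + _ = _ at this
  omega

/-- Finitely many entries of `projStep`, chosen transversally to the image of its derivative,
control all of them near a solution. -/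
lemma eventually_projStep_eq_zero {R₀ M₀ : Matrix κ κ ℝ} (hRt : R₀ᵀ = R₀) (hR : R₀ * R₀ = R₀)
    (hMt : M₀ᵀ = M₀) (hM : M₀ * M₀ = M₀) (hMR : M₀ * R₀ = M₀) (J : Finset (κ × κ))
    (hJ : ∀ W : Matrix κ κ ℝ, (R₀ - M₀) * W * M₀ = 0 → (∀ j ∈ J, W j.1 j.2 = 0) → W = 0) :
    ∀ᶠ p : Matrix κ κ ℝ × Matrix κ κ ℝ in nhds (R₀, M₀), p.1ᵀ = p.1 → p.1 * p.1 = p.1 →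
      (∀ j ∈ J, projStep p.1 p.2 j.1 j.2 = 0) → projStep p.1 p.2 = 0 := by
  let toMat : (κ × κ → ℝ) →ₗ[ℝ] Matrix κ κ ℝ :=
    { toFun := fun w => Matrix.of fun i j => w (i, j)
      map_add' := fun _ _ => rfl
      map_smul' := fun _ _ => rfl }
  let ofMat : Matrix κ κ ℝ →ₗ[ℝ] (κ × κ → ℝ) :=
    { toFun := fun W j => W j.1 j.2
      map_add' := fun _ _ => rfl
      map_smul' := fun _ _ => rfl }
  let restr : (κ × κ → ℝ) →ₗ[ℝ] (κ × κ → ℝ) :=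
    LinearMap.pi fun j => if j ∈ J then LinearMap.proj j else 0
  let Φ : Matrix κ κ ℝ × Matrix κ κ ℝ → (κ × κ → ℝ) →ₗ[ℝ] (κ × κ → ℝ) × (κ × κ → ℝ) := fun p =>
    restr.prod (ofMat ∘ₗ projStepSyzygy p.1 p.2 ∘ₗ toMat)
  have hsum : ∀ p w, Φ p w = ∑ e, w e • Φ p (fun j => if e = j then 1 else 0) := fun p w =>
    LinearMap.pi_apply_eq_sum_univ (Φ p) w
  have hcont : Continuous fun p => fun e : κ × κ => Φ p (fun j => if e = j then 1 else 0) := by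
    refine continuous_pi fun e => Continuous.prodMk continuous_const (continuous_pi fun j => ?_)
    have : Continuous fun p : Matrix κ κ ℝ × Matrix κ κ ℝ =>
        projStepSyzygy p.1 p.2 (toMat fun j => if e = j then 1 else 0) := by
      simp only [projStepSyzygy_apply, projStep]
      fun_prop
    exact this.matrix_elem j.1 j.2
  have hbase : LinearIndependent ℝ
      fun e : κ × κ => Φ (R₀, M₀) (fun j => if e = j then 1 else 0) := by
    rw [Fintype.linearIndependent_iff]
    intro w hw e
    rw [← hsum] at hw
    have hz : toMat w = 0 := by
      refine hJ _ (projStepSyzygy_injOn hRt hR hMt hM hMR ?_) fun j hj => ?_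
      · ext i j
        exact congrFun (congrArg Prod.snd hw) (i, j)
      · have h := congrFun (congrArg Prod.fst hw) j
        have : w j = 0 := by simpa [Φ, restr, hj] using h
        exact this
    exact congrFun (congrFun hz e.1) e.2
  filter_upwards [hcont.continuousAt.eventually hbase.eventually] with p hp hpt hpp hpJ
  rw [Fintype.linearIndependent_iff] at hp
  have hz := hp (fun e => projStep p.1 p.2 e.1 e.2) (by
    rw [← hsum]
    refine Prod.ext (funext fun j => ?_) (funext fun j => ?_)
    · by_cases hj : j ∈ J
      · simpa [Φ, restr, hj] using hpJ j hj
      · simp [Φ, restr, hj]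
    · exact congrFun (congrFun (projStepSyzygy_projStep hpt hpp) j.1) j.2)
  ext i j
  exact hz (i, j)

end ProjectionStepRank

section ProjectionChain

open Matrix

variable {κ A B : Type*} [Fintype κ]

lemma sub_isProj [CommRing A] {D Y : Matrix κ κ A} (hDt : Dᵀ = D) (hD : D * D = D)
    (hYt : Yᵀ = Y) (hY : Y * Y = Y) (hYD : Y * D = Y) :
    (D - Y)ᵀ = D - Y ∧ (D - Y) * (D - Y) = D - Y := by
  have hDY : D * Y = Y := by
    have := congrArg Matrix.transpose hYD
    rwa [Matrix.transpose_mul, hYt, hDt] at this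
  refine ⟨by rw [Matrix.transpose_sub, hDt, hYt], ?_⟩
  rw [Matrix.sub_mul, Matrix.mul_sub, Matrix.mul_sub, hD, hY, hYD, hDY]
  abel

/-- `projStep` detects the projections `Y'` lying between the projections `Y ≤ D`. -/
lemma projStep_sub_eq_zero_iff [CommRing A] {D Y Y' : Matrix κ κ A} (hDt : Dᵀ = D)
    (hD : D * D = D) (hYt : Yᵀ = Y) (hY : Y * Y = Y) (hYD : Y * D = Y) :
    projStep (D - Y) (Y' - Y) = 0 ↔ Y'ᵀ = Y' ∧ Y' * Y' = Y' ∧ Y' * D = Y' ∧ Y' * Y = Y := by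
  have hDY : D * Y = Y := by
    have := congrArg Matrix.transpose hYD
    rwa [Matrix.transpose_mul, hYt, hDt] at this
  obtain ⟨hRt, hR⟩ := sub_isProj hDt hD hYt hY hYD
  rw [projStep_eq_zero_iff hRt hR]
  constructor
  · rintro ⟨ht, hM, hMR⟩
    rw [Matrix.transpose_sub, hYt, sub_left_inj] at ht
    have h1 : Y' * Y = Y := by
      have : (Y' - Y) * (D - Y) * Y = Y' * (D * Y) - Y' * (Y * Y) - Y * (D * Y) + Y * (Y * Y) := by
        noncomm_ring
      rw [hMR, hDY, hY, Matrix.sub_mul, hY] at this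
      rw [← sub_eq_zero, this]
      abel
    have h2 : Y * Y' = Y := by
      have := congrArg Matrix.transpose h1
      rwa [Matrix.transpose_mul, hYt, ht] at this
    refine ⟨ht, ?_, ?_, h1⟩
    · rw [Matrix.sub_mul, Matrix.mul_sub, Matrix.mul_sub, h1, h2, hY, sub_self, sub_zero,
        sub_left_inj] at hM
      exact hM
    · rw [Matrix.sub_mul, Matrix.mul_sub, Matrix.mul_sub, h1, hY, hYD, sub_self, sub_zero,
        sub_left_inj] at hMR
      exact hMR
  · rintro ⟨ht, hY', hYD', h1⟩
    have h2 : Y * Y' = Y := by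
      have := congrArg Matrix.transpose h1
      rwa [Matrix.transpose_mul, hYt, ht] at this
    refine ⟨by rw [Matrix.transpose_sub, ht, hYt], ?_, ?_⟩
    · rw [Matrix.sub_mul, Matrix.mul_sub, Matrix.mul_sub, h1, h2, hY, hY', sub_self, sub_zero]
    · rw [Matrix.sub_mul, Matrix.mul_sub, Matrix.mul_sub, h1, hY, hYD, hYD', sub_self, sub_zero]

lemma projStep_map [CommRing A] [CommRing B] (f : A →+* B) (R M : Matrix κ κ A) :
    (projStep R M).map f = projStep (R.map f) (M.map f) := by
  simp only [projStep, Matrix.map_sub f (map_sub f), Matrix.map_mul, Matrix.transpose_map]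

/-- The derivative of `projStep` in its second argument, along a derivation `δ` over `f`. -/
lemma projStep_map_derivation [CommRing A] [CommRing B] (f : A →+* B) (δ : A →+ B)
    (hδ : ∀ x y, δ (x * y) = δ x * f y + f x * δ y) {R M : Matrix κ κ A} (hR : R.map δ = 0) :
    (projStep R M).map δ = projStepDeriv (R.map f) (M.map f) (M.map δ) := by
  have hmul : ∀ P Q : Matrix κ κ A,
      (P * Q).map δ = P.map δ * Q.map f + P.map f * Q.map δ := by
    intro P Q
    ext i j
    simp [Matrix.mul_apply, hδ, Finset.sum_add_distrib]
  rw [projStep, Matrix.map_sub δ (map_sub δ), hmul, hmul, hmul, hR, projStepDeriv]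
  simp only [Matrix.zero_mul, Matrix.mul_zero, zero_add, add_zero, Matrix.map_mul,
    Matrix.transpose_map]
  noncomm_ring

end ProjectionChain

section StdProj

lemma stdProj_transpose (k ℓ : ℕ) : (stdProj k ℓ).transpose = stdProj k ℓ :=
  Matrix.diagonal_transpose _

lemma stdProj_mul_of_le {k s t : ℕ} (h : s ≤ t) : stdProj k s * stdProj k t = stdProj k s := by
  rw [stdProj, stdProj, Matrix.diagonal_mul_diagonal]
  congr 1
  funext i
  split_ifs <;> first | omega | norm_num

lemma stdProj_self (k : ℕ) : stdProj k k = 1 := by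
  simp [stdProj]

lemma trace_stdProj {k ℓ : ℕ} (h : ℓ ≤ k) : (stdProj k ℓ).trace = ℓ := by
  rw [stdProj, Matrix.trace_diagonal, Finset.sum_ite, Finset.sum_const_zero, add_zero,
    Finset.sum_const, nsmul_one, Fin.card_filter_val_lt, min_eq_right h]

end StdProj

section PartialSum

variable {c : ℕ} (f : Fin c → ℕ)

lemma partialSum_zero : partialSum f 0 = 0 := by
  simp [partialSum]

lemma partialSum_mono : Monotone (partialSum f) := fun s t h =>
  Finset.sum_le_sum_of_subset fun i => by
    simp only [Finset.mem_filter, Finset.mem_univ, true_and]; omega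

lemma partialSum_succ (t : Fin c) : partialSum f (t + 1) = partialSum f t + f t := by
  have : Finset.univ.filter (fun i : Fin c => (i : ℕ) < t + 1) =
      insert t (Finset.univ.filter (fun i : Fin c => (i : ℕ) < t)) := by
    ext i
    simp only [Finset.mem_filter, Finset.mem_univ, true_and, Finset.mem_insert, Fin.ext_iff]
    omega
  rw [partialSum, this, Finset.sum_insert (by simp), add_comm, partialSum]

lemma partialSum_self : partialSum f c = ∑ i, f i := by
  simp [partialSum]

lemma partialSum_add_tail (t : ℕ) :
    partialSum f (t + 1) + ∑ i ∈ Finset.univ.filter (fun i : Fin c => t < (i : ℕ)), f i =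
      ∑ i, f i := by
  rw [partialSum,
    ← Finset.sum_filter_add_sum_filter_not Finset.univ (fun i : Fin c => (i : ℕ) < t + 1)]
  congr 2
  ext i
  simp only [Finset.mem_filter, Finset.mem_univ, true_and]
  omega

/-- A function constant on consecutive blocks of lengths `f i` is summed blockwise. -/
lemma sum_eq_sum_mul_of_blocks {m : ℕ} (hf : ∑ i, f i = m) (lam : Fin m → ℕ) (T : Fin c → ℕ)
    (h : ∀ (i : Fin c) (j : Fin m), partialSum f i < (j : ℕ) + 1 →
      (j : ℕ) + 1 ≤ partialSum f (i + 1) → lam j = T i) :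
    ∑ j, lam j = ∑ i, f i * T i := by
  subst hf
  rw [← Equiv.sum_comp finSigmaFinEquiv, Fintype.sum_sigma]
  refine Finset.sum_congr rfl fun i _ => ?_
  rw [Finset.sum_congr rfl fun r _ => h i (finSigmaFinEquiv ⟨i, r⟩) ?_ ?_]
  · simp
  all_goals
    have hp : partialSum f i = ∑ s : Fin i, f (Fin.castLE i.2.le s) := by
      rw [partialSum]
      refine (Finset.sum_bij (fun s _ => Fin.castLE i.2.le s) ?_ ?_ ?_ ?_).symm
      · intro s _
        exact Finset.mem_filter.2 ⟨Finset.mem_univ _, s.2⟩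
      · intro s _ t _ hst; simpa [Fin.ext_iff] using hst
      · intro t ht
        exact ⟨⟨t, by simpa using ht⟩, Finset.mem_univ _, rfl⟩
      · intro s _; rfl
    have := r.2
    rw [finSigmaFinEquiv_apply]
    first
    | rw [partialSum_succ, hp]; dsimp only; omega
    | rw [hp]; dsimp only; omega

end PartialSum

section DirectionalDerivative

variable {ι : Type*} [Fintype ι]

/-- The derivative at `z` in the direction `H` of polynomials with rational coefficients. -/
noncomputable def polyDirDeriv (z H : ι → ℝ) : MvPolynomial ι ℚ →+ ℝ where
  toFun p := ∑ i, H i * polyGradQ p z i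
  map_zero' := by simp [polyGradQ]
  map_add' p q := by simp [polyGradQ, mul_add, Finset.sum_add_distrib]

lemma polyDirDeriv_apply (z H : ι → ℝ) (p : MvPolynomial ι ℚ) :
    polyDirDeriv z H p = ∑ i, H i * polyGradQ p z i := rfl

lemma polyDirDeriv_mul (z H : ι → ℝ) (p q : MvPolynomial ι ℚ) :
    polyDirDeriv z H (p * q) =
      polyDirDeriv z H p * aeval z q + aeval z p * polyDirDeriv z H q := by
  simp only [polyDirDeriv_apply, polyGradQ, Derivation.leibniz, map_add, smul_eq_mul, map_mul,
    Finset.sum_mul, Finset.mul_sum, ← Finset.sum_add_distrib]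
  exact Finset.sum_congr rfl fun i _ => by ring

lemma polyDirDeriv_X (z H : ι → ℝ) (i : ι) : polyDirDeriv z H (X i) = H i := by
  classical
  rw [polyDirDeriv_apply, Finset.sum_eq_single i]
  · simp [polyGradQ]
  · intro j _ hj
    simp [polyGradQ, pderiv_X, hj.symm]
  · simp

end DirectionalDerivative

section BottSamelsonChain

variable {c k : ℕ} (hc : 0 < c)

/-- The slot carrying `Y_t` for `1 ≤ t ≤ c`, where `Y_c = X` sits in slot `0`. -/
def chainSlot (t : ℕ) : Fin c := ⟨t % c, Nat.mod_lt t hc⟩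

lemma chainSlot_inj {s t : ℕ} (hs : 0 < s) (hs' : s ≤ c) (ht : 0 < t) (ht' : t ≤ c)
    (h : chainSlot hc s = chainSlot hc t) : s = t := by
  have h' : s % c = t % c := congrArg Fin.val h
  rcases hs'.lt_or_eq with hs1 | rfl <;> rcases ht'.lt_or_eq with ht1 | rfl
  · rwa [Nat.mod_eq_of_lt hs1, Nat.mod_eq_of_lt ht1] at h'
  · rw [Nat.mod_eq_of_lt hs1, Nat.mod_self] at h'; omega
  · rw [Nat.mod_eq_of_lt ht1, Nat.mod_self] at h'; omega
  · rfl

/-- The chain `0 = Y_0, Y_1, …, Y_{c-1}, Y_c = X` of matrices of a point. -/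
def chainMat (z : Fin c × (Fin k × Fin k) → ℝ) (t : ℕ) : Matrix (Fin k) (Fin k) ℝ :=
  if t = 0 then 0 else matSlot z (chainSlot hc t)

/-- The generic version of `chainMat`. -/
noncomputable def chainPoly (t : ℕ) :
    Matrix (Fin k) (Fin k) (MvPolynomial (Fin c × (Fin k × Fin k)) ℚ) :=
  if t = 0 then 0 else Matrix.of fun p q => X (chainSlot hc t, (p, q))

/-- The matrix `D_ℓ` with polynomial entries. -/
noncomputable def stdProjPoly (c k ℓ : ℕ) :
    Matrix (Fin k) (Fin k) (MvPolynomial (Fin c × (Fin k × Fin k)) ℚ) :=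
  Matrix.diagonal fun i => if (i : ℕ) < ℓ then 1 else 0

/-- The equations for `Y_{t+1}` to be a projection between `Y_t` and `D_ℓ`. -/
noncomputable def chainStepPoly (ℓ t : ℕ) :
    Matrix (Fin k) (Fin k) (MvPolynomial (Fin c × (Fin k × Fin k)) ℚ) :=
  projStep (stdProjPoly c k ℓ - chainPoly hc t) (chainPoly hc (t + 1) - chainPoly hc t)

variable (z : Fin c × (Fin k × Fin k) → ℝ)

lemma chainMat_zero : chainMat hc z 0 = 0 := if_pos rfl

lemma continuous_chainMat (t : ℕ) :
    Continuous fun z : Fin c × (Fin k × Fin k) → ℝ => chainMat hc z t := by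
  unfold chainMat matSlot
  split_ifs
  · exact continuous_const
  · exact continuous_matrix fun p q => continuous_apply _

lemma chainPoly_map_aeval (t : ℕ) :
    (chainPoly hc t).map (aeval z : MvPolynomial _ ℚ →ₐ[ℚ] ℝ).toRingHom = chainMat hc z t := by
  unfold chainPoly chainMat
  split_ifs
  · exact Matrix.map_zero _ (map_zero _)
  · ext p q
    simp [matSlot]

lemma stdProjPoly_map_aeval (ℓ : ℕ) :
    (stdProjPoly c k ℓ).map (aeval z : MvPolynomial _ ℚ →ₐ[ℚ] ℝ).toRingHom = stdProj k ℓ := by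
  rw [stdProjPoly, stdProj, Matrix.diagonal_map (map_zero _)]
  congr 1
  funext i
  split_ifs <;> simp

lemma aeval_chainStepPoly (ℓ t : ℕ) (p q : Fin k) :
    aeval z (chainStepPoly hc ℓ t p q) =
      projStep (stdProj k ℓ - chainMat hc z t) (chainMat hc z (t + 1) - chainMat hc z t) p q := by
  have h := projStep_map (aeval z : MvPolynomial _ ℚ →ₐ[ℚ] ℝ).toRingHom
    (stdProjPoly c k ℓ - chainPoly hc t) (chainPoly hc (t + 1) - chainPoly hc t)
  rw [Matrix.map_sub _ (map_sub _), Matrix.map_sub _ (map_sub _), chainPoly_map_aeval,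
    chainPoly_map_aeval, stdProjPoly_map_aeval] at h
  exact congrFun (congrFun h p) q

/-- The tangent vector with matrix `H` in the slot `s` and `0` elsewhere. -/
def slotVec (s : Fin c) (H : Matrix (Fin k) (Fin k) ℝ) : Fin c × (Fin k × Fin k) → ℝ :=
  fun i => if i.1 = s then H i.2.1 i.2.2 else 0

lemma polyDirDeriv_slotVec (s : Fin c) (H : Matrix (Fin k) (Fin k) ℝ)
    (p : MvPolynomial (Fin c × (Fin k × Fin k)) ℚ) :
    polyDirDeriv z (slotVec s H) p = ∑ i, H i.1 i.2 * polyGradQ p z (s, i) := by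
  rw [polyDirDeriv_apply, Fintype.sum_prod_type, Finset.sum_eq_single s]
  · simp [slotVec]
  · intro t _ ht
    simp [slotVec, ht]
  · simp

lemma chainPoly_map_polyDirDeriv_of_ne {s : Fin c} {t : ℕ} (h : t = 0 ∨ chainSlot hc t ≠ s)
    (H : Matrix (Fin k) (Fin k) ℝ) :
    (chainPoly hc t).map (polyDirDeriv z (slotVec s H)) = 0 := by
  unfold chainPoly
  split_ifs with ht
  · exact Matrix.map_zero _ (map_zero _)
  · ext p q
    simp [polyDirDeriv_X, slotVec, h.resolve_left ht]

lemma chainPoly_map_polyDirDeriv_self {t : ℕ} (h : t ≠ 0) (H : Matrix (Fin k) (Fin k) ℝ) :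
    (chainPoly hc t).map (polyDirDeriv z (slotVec (chainSlot hc t) H)) = H := by
  ext p q
  simp [chainPoly, h, polyDirDeriv_X, slotVec]

lemma stdProjPoly_map_polyDirDeriv (ℓ : ℕ) (H : Fin c × (Fin k × Fin k) → ℝ) :
    (stdProjPoly c k ℓ).map (polyDirDeriv z H) = 0 := by
  have h1 : polyDirDeriv z H 1 = 0 := by simp [polyDirDeriv_apply, polyGradQ]
  rw [stdProjPoly, Matrix.diagonal_map (map_zero _)]
  ext p q
  by_cases hpq : p = q
  · subst hpq
    by_cases hp : (p : ℕ) < ℓ <;> simp [hp, h1]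
  · simp [hpq]

lemma polyDirDeriv_chainStepPoly (ℓ : ℕ) {t : ℕ} {s : Fin c} (h : t = 0 ∨ chainSlot hc t ≠ s)
    (H : Matrix (Fin k) (Fin k) ℝ) (p q : Fin k) :
    polyDirDeriv z (slotVec s H) (chainStepPoly hc ℓ t p q) =
      projStepDeriv (stdProj k ℓ - chainMat hc z t) (chainMat hc z (t + 1) - chainMat hc z t)
        ((chainPoly hc (t + 1)).map (polyDirDeriv z (slotVec s H))) p q := by
  set δ := polyDirDeriv z (slotVec s H)
  have h0 : (chainPoly hc t).map δ = 0 := chainPoly_map_polyDirDeriv_of_ne hc z h H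
  have h1 := projStep_map_derivation (aeval z : MvPolynomial _ ℚ →ₐ[ℚ] ℝ).toRingHom δ
    (polyDirDeriv_mul z _) (R := stdProjPoly c k ℓ - chainPoly hc t)
    (M := chainPoly hc (t + 1) - chainPoly hc t)
    (by rw [Matrix.map_sub _ (map_sub _), h0, stdProjPoly_map_polyDirDeriv, sub_zero])
  rw [Matrix.map_sub _ (map_sub _), Matrix.map_sub _ (map_sub _), Matrix.map_sub _ (map_sub _),
    chainPoly_map_aeval, chainPoly_map_aeval, stdProjPoly_map_aeval, h0, sub_zero] at h1
  exact congrFun (congrFun h1 p) q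

/-- In the newest slot, the derivative of the step equations is `projStepDeriv`. -/
lemma sum_mul_polyGradQ_chainStepPoly (ℓ : ℕ) {t : ℕ} (ht : t < c)
    (H : Matrix (Fin k) (Fin k) ℝ) (p q : Fin k) :
    ∑ i, H i.1 i.2 * polyGradQ (chainStepPoly hc ℓ t p q) z (chainSlot hc (t + 1), i) =
      projStepDeriv (stdProj k ℓ - chainMat hc z t) (chainMat hc z (t + 1) - chainMat hc z t)
        H p q := by
  have hne : t = 0 ∨ chainSlot hc t ≠ chainSlot hc (t + 1) := by
    by_contra! h
    have := chainSlot_inj hc (by omega) ht.le (by omega) (by omega) h.2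
    omega
  rw [← polyDirDeriv_slotVec, polyDirDeriv_chainStepPoly hc z ℓ hne,
    chainPoly_map_polyDirDeriv_self hc z (by omega)]

/-- The step equations do not involve the later slots. -/
lemma polyGradQ_chainStepPoly_eq_zero (ℓ : ℕ) {s t : ℕ} (hst : s < t) (ht : t < c)
    (p q : Fin k) (i : Fin k × Fin k) :
    polyGradQ (chainStepPoly hc ℓ s p q) z (chainSlot hc (t + 1), i) = 0 := by
  have hne : ∀ r, r ≤ t → r = 0 ∨ chainSlot hc r ≠ chainSlot hc (t + 1) := by
    intro r hr
    by_contra! h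
    have := chainSlot_inj hc (by omega) (by omega) (by omega) (by omega) h.2
    omega
  have h := polyDirDeriv_chainStepPoly hc z ℓ (hne s hst.le)
    (Matrix.of fun x y => if (x, y) = i then 1 else 0) p q
  rw [chainPoly_map_polyDirDeriv_of_ne hc z (hne (s + 1) hst), polyDirDeriv_slotVec,
    Finset.sum_eq_single i] at h
  · simpa [projStepDeriv] using h
  · intro j _ hj
    simp [hj]
  · simp

end BottSamelsonChain

section BottSamelsonEquations

variable {c k : ℕ}

/-- If each step equation holds as soon as the previous terms form a chain of projections
`Y_t ≤ D_{d t}`, then all terms form such a chain. -/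
lemma isProj_of_projStep {Y : ℕ → Matrix (Fin k) (Fin k) ℝ} {d : ℕ → ℕ} (hd : Monotone d)
    (h0 : Y 0 = 0)
    (h : ∀ t < c, (stdProj k (d (t + 1)) - Y t).transpose = stdProj k (d (t + 1)) - Y t →
      (stdProj k (d (t + 1)) - Y t) * (stdProj k (d (t + 1)) - Y t) = stdProj k (d (t + 1)) - Y t →
      projStep (stdProj k (d (t + 1)) - Y t) (Y (t + 1) - Y t) = 0) :
    (∀ t ≤ c, (Y t).transpose = Y t ∧ Y t * Y t = Y t ∧ Y t * stdProj k (d t) = Y t) ∧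
      ∀ t < c, Y (t + 1) * Y t = Y t := by
  have hstep : ∀ t < c, ((Y t).transpose = Y t ∧ Y t * Y t = Y t ∧ Y t * stdProj k (d t) = Y t) →
      ((Y (t + 1)).transpose = Y (t + 1) ∧ Y (t + 1) * Y (t + 1) = Y (t + 1) ∧
        Y (t + 1) * stdProj k (d (t + 1)) = Y (t + 1) ∧ Y (t + 1) * Y t = Y t) := by
    rintro t ht ⟨hYt, hY, hYD⟩
    have hYD' : Y t * stdProj k (d (t + 1)) = Y t := by
      rw [← hYD, Matrix.mul_assoc, stdProj_mul_of_le (hd t.le_succ)]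
    have hDt := stdProj_transpose k (d (t + 1))
    have hD := stdProj_mul_of_le (k := k) (le_refl (d (t + 1)))
    obtain ⟨hRt, hR⟩ := sub_isProj hDt hD hYt hY hYD'
    exact (projStep_sub_eq_zero_iff hDt hD hYt hY hYD').1 (h t ht hRt hR)
  have hall : ∀ t ≤ c,
      (Y t).transpose = Y t ∧ Y t * Y t = Y t ∧ Y t * stdProj k (d t) = Y t := by
    intro t
    induction t with
    | zero => simp [h0]
    | succ t ih =>
      intro ht
      obtain ⟨h1, h2, h3, -⟩ := hstep t ht (ih (by omega))
      exact ⟨h1, h2, h3⟩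
  exact ⟨hall, fun t ht => (hstep t ht (hall t ht.le)).2.2.2⟩

lemma projStep_eq_zero_of_isProj {Y : ℕ → Matrix (Fin k) (Fin k) ℝ} {d : ℕ → ℕ}
    (hd : Monotone d)
    (h : ∀ t ≤ c, (Y t).transpose = Y t ∧ Y t * Y t = Y t ∧ Y t * stdProj k (d t) = Y t)
    (h' : ∀ t < c, Y (t + 1) * Y t = Y t) (t : ℕ) (ht : t < c) :
    projStep (stdProj k (d (t + 1)) - Y t) (Y (t + 1) - Y t) = 0 := by
  obtain ⟨hYt, hY, hYD⟩ := h t ht.le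
  obtain ⟨hYt', hY', hYD'⟩ := h (t + 1) ht
  have hYD₁ : Y t * stdProj k (d (t + 1)) = Y t := by
    rw [← hYD, Matrix.mul_assoc, stdProj_mul_of_le (hd t.le_succ)]
  exact (projStep_sub_eq_zero_iff (stdProj_transpose k _) (stdProj_mul_of_le le_rfl) hYt hY
    hYD₁).2 ⟨hYt', hY', hYD', h' t ht⟩

variable {m n : ℕ} (hc : 0 < c) {a b : Fin c → ℕ}

lemma partialSum_add_mono (a b : Fin c → ℕ) : Monotone fun t => partialSum a t + partialSum b t :=
  fun _ _ h => add_le_add (partialSum_mono a h) (partialSum_mono b h)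

lemma chainMat_of_lt (z : Fin c × (Fin k × Fin k) → ℝ) {t : ℕ} (h0 : 0 < t) (ht : t < c) :
    chainMat hc z t = matSlot z ⟨t, ht⟩ := by
  rw [chainMat, if_neg h0.ne']
  congr 1
  exact Fin.ext (Nat.mod_eq_of_lt ht)

lemma chainMat_self (z : Fin c × (Fin k × Fin k) → ℝ) :
    chainMat hc z c = matSlot z ⟨0, hc⟩ := by
  rw [chainMat, if_neg hc.ne']
  congr 1
  exact Fin.ext (Nat.mod_self c)

/-- The Bott–Samelson set in terms of the chain `0 = Y_0 ≤ Y_1 ≤ ⋯ ≤ Y_c = X`. -/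
lemma mem_bottSamelson_iff_chain (hsa : ∑ i, a i = m) (hsb : ∑ i, b i = n)
    (z : Fin c × (Fin (m + n) × Fin (m + n)) → ℝ) :
    z ∈ BottSamelson m n c hc a b ↔
      (∀ t ≤ c, chainMat hc z t ∈ GrassMatrix (m + n) (partialSum a t) ∧
        chainMat hc z t * stdProj (m + n) (partialSum a t + partialSum b t) = chainMat hc z t) ∧
      ∀ t < c, chainMat hc z (t + 1) * chainMat hc z t = chainMat hc z t := by
  constructor
  · rintro ⟨hX, hY, hYY, hXY⟩
    refine ⟨fun t ht => ?_, fun t ht => ?_⟩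
    · rcases Nat.eq_zero_or_pos t with rfl | h0
      · simp [chainMat_zero, GrassMatrix, partialSum_zero]
      · rcases ht.lt_or_eq with h | rfl
        · rw [chainMat_of_lt hc z h0 h]
          exact hY ⟨t, h⟩ h0
        · rw [chainMat_self, partialSum_self, partialSum_self, hsa, hsb, stdProj_self]
          exact ⟨hX, Matrix.mul_one _⟩
    · rcases Nat.eq_zero_or_pos t with rfl | h0
      · simp [chainMat_zero]
      · rw [chainMat_of_lt hc z h0 ht]
        rcases Nat.lt_or_eq_of_le (Nat.succ_le_of_lt ht) with h | h
        · rw [chainMat_of_lt hc z (Nat.succ_pos t) h]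
          exact hYY ⟨t, ht⟩ h0 h
        · have : chainMat hc z (t + 1) = matSlot z ⟨0, hc⟩ := by
            rw [show t + 1 = c from h, chainMat_self]
          rw [this]
          exact hXY ⟨t, ht⟩ h0 (by simp only; omega)
  · rintro ⟨h1, h2⟩
    refine ⟨?_, fun j hj => ?_, fun j hj hj' => ?_, fun j hj hj' => ?_⟩
    · have := (h1 c le_rfl).1
      rwa [chainMat_self, partialSum_self, hsa] at this
    · have := h1 j j.2.le
      rwa [chainMat_of_lt hc z hj j.2] at this
    · have := h2 j j.2
      rwa [chainMat_of_lt hc z hj j.2, chainMat_of_lt hc z (Nat.succ_pos _) hj'] at this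
    · have := h2 j j.2
      rwa [chainMat_of_lt hc z hj j.2, show (j : ℕ) + 1 = c by omega, chainMat_self] at this

/-- The Bott–Samelson set is cut out by the step equations and the trace conditions. -/
lemma mem_bottSamelson_iff_projStep (hsa : ∑ i, a i = m) (hsb : ∑ i, b i = n)
    (z : Fin c × (Fin (m + n) × Fin (m + n)) → ℝ) :
    z ∈ BottSamelson m n c hc a b ↔
      (∀ t < c, projStep
        (stdProj (m + n) (partialSum a (t + 1) + partialSum b (t + 1)) - chainMat hc z t)
        (chainMat hc z (t + 1) - chainMat hc z t) = 0) ∧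
      ∀ t < c, (chainMat hc z (t + 1)).trace = partialSum a (t + 1) := by
  rw [mem_bottSamelson_iff_chain hc hsa hsb]
  constructor
  · rintro ⟨h1, h2⟩
    exact ⟨projStep_eq_zero_of_isProj (Y := chainMat hc z)
      (d := fun t => partialSum a t + partialSum b t) (partialSum_add_mono a b)
      (fun t ht => ⟨(h1 t ht).1.1, (h1 t ht).1.2.1, (h1 t ht).2⟩) h2,
      fun t ht => (h1 (t + 1) ht).1.2.2⟩
  · rintro ⟨h1, h2⟩
    obtain ⟨h3, h4⟩ := isProj_of_projStep (c := c) (Y := chainMat hc z)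
      (d := fun t => partialSum a t + partialSum b t) (partialSum_add_mono a b) (chainMat_zero hc z)
      fun t ht _ _ => h1 t ht
    refine ⟨fun t ht => ⟨⟨(h3 t ht).1, (h3 t ht).2.1, ?_⟩, (h3 t ht).2.2⟩, h4⟩
    rcases t with _ | t
    · simp [chainMat_zero, partialSum_zero]
    · exact h2 t ht

lemma isQAlgebraicSet_bottSamelson (hsa : ∑ i, a i = m) (hsb : ∑ i, b i = n) :
    IsQAlgebraicSet (BottSamelson m n c hc a b) := by
  classical
  let E : Fin c × (Fin (m + n) × Fin (m + n)) →
      MvPolynomial (Fin c × (Fin (m + n) × Fin (m + n))) ℚ := fun i =>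
    chainStepPoly hc (partialSum a (i.1 + 1) + partialSum b (i.1 + 1)) i.1 i.2.1 i.2.2
  let T : Fin c → MvPolynomial (Fin c × (Fin (m + n) × Fin (m + n))) ℚ := fun t =>
    (chainPoly hc (t + 1)).trace - C (partialSum a (t + 1) : ℚ)
  have hT : ∀ z t, aeval z (T t) = (chainMat hc z (t + 1)).trace - partialSum a (t + 1) := by
    intro z t
    have h := AddMonoidHom.map_trace
      (aeval z : MvPolynomial (Fin c × (Fin (m + n) × Fin (m + n))) ℚ →ₐ[ℚ] ℝ).toRingHom
      (chainPoly (k := m + n) hc (t + 1))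
    rw [chainPoly_map_aeval] at h
    rw [map_sub, ← h]
    simp
  refine ⟨Finset.univ.image E ∪ Finset.univ.image T, ?_⟩
  ext z
  rw [mem_bottSamelson_iff_projStep hc hsa hsb, Set.mem_ofPred_eq]
  constructor
  · rintro ⟨h1, h2⟩ p hp
    rcases Finset.mem_union.1 hp with hp | hp <;> obtain ⟨i, -, rfl⟩ := Finset.mem_image.1 hp
    · rw [aeval_chainStepPoly, h1 i.1 i.1.2]
      rfl
    · rw [hT, h2 i i.2, sub_self]
  · intro h
    refine ⟨fun t ht => ?_, fun t ht => ?_⟩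
    · ext p q
      have := h (E (⟨t, ht⟩, (p, q)))
        (Finset.mem_union_left _ (Finset.mem_image_of_mem _ (Finset.mem_univ _)))
      rwa [aeval_chainStepPoly] at this
    · have := h (T ⟨t, ht⟩)
        (Finset.mem_union_right _ (Finset.mem_image_of_mem _ (Finset.mem_univ _)))
      rw [hT] at this
      exact sub_eq_zero.1 this

lemma sum_sq_of_mem_grassMatrix {r : ℕ} {Y : Matrix (Fin k) (Fin k) ℝ} (hY : Y ∈ GrassMatrix k r) :
    ∑ i : Fin k × Fin k, Y i.1 i.2 ^ 2 = r := by
  obtain ⟨ht, hY, htr⟩ := hY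
  rw [← htr, ← hY, Fintype.sum_prod_type, Matrix.trace]
  refine Finset.sum_congr rfl fun p _ => ?_
  rw [Matrix.diag_apply, Matrix.mul_apply, hY]
  refine Finset.sum_congr rfl fun q _ => ?_
  have : Y q p = Y p q := congrFun (congrFun ht p) q
  rw [this, sq]

lemma isProjQClosed_bottSamelson (hsa : ∑ i, a i = m) (hsb : ∑ i, b i = n) :
    IsProjQClosed (BottSamelson m n c hc a b) := by
  refine (isQAlgebraicSet_bottSamelson hc hsa hsb).isProjQClosed_of_sum_sq
    (∑ j : Fin c, if (j : ℕ) = 0 then (m : ℚ) else partialSum a j) ?_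
  rintro z ⟨hX, hY, -, -⟩
  rw [Fintype.sum_prod_type]
  push_cast
  refine Finset.sum_congr rfl fun j _ => ?_
  split_ifs with hj
  · have : j = ⟨0, hc⟩ := Fin.ext hj
    subst this
    exact sum_sq_of_mem_grassMatrix hX
  · exact sum_sq_of_mem_grassMatrix (hY j (Nat.pos_of_ne_zero hj)).1

/-- An idempotent matrix whose trace is within `1` of a natural number has that trace. -/
lemma trace_eq_of_abs_sub_lt_one {Y : Matrix (Fin k) (Fin k) ℝ} (hY : Y * Y = Y) {r : ℕ}
    (h : |Y.trace - r| < 1) : Y.trace = r := by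
  rw [Matrix.trace_eq_rank_of_mul_self hY] at h ⊢
  have h' : |(Y.rank : ℤ) - r| < 1 := by exact_mod_cast h
  have := Int.abs_lt_one_iff.1 h'
  have : (Y.rank : ℤ) = r := by omega
  exact_mod_cast this

/-- Rows of the Jacobian of one step, forming a basis of its row space. -/
lemma exists_chainStepPoly_basis (hsa : ∑ i, a i = m) (hsb : ∑ i, b i = n)
    {z : Fin c × (Fin (m + n) × Fin (m + n)) → ℝ} (hz : z ∈ BottSamelson m n c hc a b)
    (t : Fin c) :
    ∃ J : Finset (Fin (m + n) × Fin (m + n)),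
      J.card + a t * partialSum b (t + 1) = Fintype.card (Fin (m + n) × Fin (m + n)) ∧
      LinearIndependent ℝ (fun j : J => fun i => polyGradQ
        (chainStepPoly hc (partialSum a (t + 1) + partialSum b (t + 1)) t j.1.1 j.1.2) z
        (chainSlot hc (t + 1), i)) ∧
      ∀ᶠ x in nhds z,
        (∀ j ∈ J, aeval x
          (chainStepPoly hc (partialSum a (t + 1) + partialSum b (t + 1)) t j.1 j.2) = 0) →
        (stdProj (m + n) (partialSum a (t + 1) + partialSum b (t + 1)) -
          chainMat hc x t).transpose =
          stdProj (m + n) (partialSum a (t + 1) + partialSum b (t + 1)) - chainMat hc x t →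
        (stdProj (m + n) (partialSum a (t + 1) + partialSum b (t + 1)) - chainMat hc x t) *
          (stdProj (m + n) (partialSum a (t + 1) + partialSum b (t + 1)) - chainMat hc x t) =
          stdProj (m + n) (partialSum a (t + 1) + partialSum b (t + 1)) - chainMat hc x t →
        projStep
          (stdProj (m + n) (partialSum a (t + 1) + partialSum b (t + 1)) - chainMat hc x t)
          (chainMat hc x (t + 1) - chainMat hc x t) = 0 := by
  set d := partialSum a (t + 1) + partialSum b (t + 1) with hd
  have hstep := ((mem_bottSamelson_iff_projStep hc hsa hsb z).1 hz).1 t t.2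
  obtain ⟨h1, -⟩ := (mem_bottSamelson_iff_chain hc hsa hsb z).1 hz
  obtain ⟨⟨hYt, hY, htr⟩, hYD⟩ := h1 t t.2.le
  obtain ⟨⟨-, -, htr'⟩, -⟩ := h1 (t + 1) t.2
  have hYD' : chainMat hc z t * stdProj (m + n) d = chainMat hc z t := by
    rw [← hYD, Matrix.mul_assoc,
      stdProj_mul_of_le (partialSum_add_mono a b (Nat.le_succ (t : ℕ)))]
  have hdle : d ≤ m + n := by
    have := partialSum_add_mono a b (Nat.succ_le_of_lt t.2)
    simpa [partialSum_self, hsa, hsb] using this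
  set R := stdProj (m + n) d - chainMat hc z t with hRdef
  set M := chainMat hc z (t + 1) - chainMat hc z t with hMdef
  obtain ⟨hRt, hR⟩ := sub_isProj (stdProj_transpose _ d) (stdProj_mul_of_le le_rfl) hYt hY hYD'
  obtain ⟨hMt, hM, hMR⟩ := (projStep_eq_zero_iff hRt hR).1 hstep
  have hMtr : M.trace = a t := by
    rw [hMdef, Matrix.trace_sub, htr, htr', partialSum_succ]
    push_cast
    ring
  have hQtr : (R - M).trace = partialSum b (t + 1) := by
    rw [hRdef, hMdef, sub_sub_sub_cancel_right, Matrix.trace_sub, htr', trace_stdProj hdle, hd]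
    push_cast
    ring
  let G : Matrix (Fin (m + n) × Fin (m + n)) (Fin (m + n) × Fin (m + n)) ℝ := Matrix.of fun j i =>
    polyGradQ (chainStepPoly hc d t j.1 j.2) z (chainSlot hc (t + 1), i)
  have hG : ∀ (H : Matrix (Fin (m + n)) (Fin (m + n)) ℝ) i j,
      (G.mulVec fun p => H p.1 p.2) (i, j) = projStepDeriv R M H i j := by
    intro H i j
    rw [← sum_mul_polyGradQ_chainStepPoly hc z d t.2 H i j]
    exact Finset.sum_congr rfl fun _ _ => mul_comm _ _
  obtain ⟨J, hJcard, hJli, hJ⟩ := G.exists_finset_linearIndependent_rows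
  refine ⟨J, ?_, hJli, ?_⟩
  · rw [hJcard]
    exact rank_projStepDeriv hRt hR hMt hM hMR hMtr hQtr G hG
  · have hloc := eventually_projStep_eq_zero hRt hR hMt hM hMR J (by
      intro W hW hWJ
      obtain ⟨H, rfl⟩ := (exists_projStepDeriv_eq_iff hRt hR hMt hM hMR).2 hW
      have hzero := hJ (fun p => H p.1 p.2) fun j hj => (hG H j.1 j.2).trans (hWJ j hj)
      ext i j
      rw [← hG, hzero]
      rfl)
    have hcont : Continuous fun x : Fin c × (Fin (m + n) × Fin (m + n)) → ℝ =>
        (stdProj (m + n) d - chainMat hc x t, chainMat hc x (t + 1) - chainMat hc x t) :=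
      (continuous_const.sub (continuous_chainMat hc t)).prodMk
        ((continuous_chainMat hc _).sub (continuous_chainMat hc t))
    filter_upwards [hcont.continuousAt.eventually hloc] with x hx hxJ hxt hxx
    exact hx hxt hxx fun j hj => by rw [← hxJ j hj, aeval_chainStepPoly]

/-- Linear independence of gradients which are triangular with respect to the slots. -/
lemma linearIndependent_of_slot_triangular {κ : Type*} {τ : Fin c → Type*}
    [∀ t, Fintype (τ t)] (g : (Σ t, τ t) → Fin c × κ → ℝ) (s : Fin c → Fin c)
    (hdiag : ∀ t, LinearIndependent ℝ fun j : τ t => fun i => g ⟨t, j⟩ (s t, i))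
    (htri : ∀ r t, r < t → ∀ (j : τ r) i, g ⟨r, j⟩ (s t, i) = 0) :
    LinearIndependent ℝ g := by
  rw [Fintype.linearIndependent_iff]
  intro w hw
  have key : ∀ t : Fin c, ∀ j : τ t, w ⟨t, j⟩ = 0 := by
    intro t
    induction t using WellFoundedGT.induction with
    | ind t ih =>
      refine Fintype.linearIndependent_iff.1 (hdiag t) (fun j => w ⟨t, j⟩) ?_
      ext i
      have h := congrFun hw (s t, i)
      rw [Fintype.sum_sigma, Finset.sum_apply, Finset.sum_eq_single t] at h
      · simpa using h
      · intro r _ hr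
        rw [Finset.sum_apply]
        refine Finset.sum_eq_zero fun j _ => ?_
        rcases lt_or_gt_of_ne hr with h | h
        · simp [htri r t h]
        · simp [ih r h]
      · simp
  exact fun i => key i.1 i.2

end BottSamelsonEquations

/-- **`ℚ`-nonsingularity of embedded Bott–Samelson sets.** -/
theorem bottSamelson_isProjQClosed_isQNonsingular
    (m n c : ℕ) (hm : 0 < m) (hc : 0 < c) (lam : Fin m → ℕ)
    (hpart : IsPartitionIn n lam)
    (hlast : lam ⟨m - 1, by omega⟩ = 0) (hfirst : lam ⟨0, hm⟩ < n)
    (a b : Fin c → ℕ) (ha : ∀ i, 0 < a i) (hb : ∀ i, 0 < b i)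
    (hsa : ∑ i, a i = m) (hsb : ∑ i, b i = n)
    (hcompat : ∀ (i : Fin c) (j : Fin m),
      partialSum a (i : ℕ) < (j : ℕ) + 1 → (j : ℕ) + 1 ≤ partialSum a ((i : ℕ) + 1) →
      lam j = ∑ t ∈ Finset.univ.filter (fun t : Fin c => (i : ℕ) < (t : ℕ)), b t) :
    IsProjQClosed (BottSamelson m n c hc a b) ∧
    IsQNonsingular (m * n - ∑ k, lam k) (BottSamelson m n c hc a b) := by
  have hlocal : ∀ z ∈ BottSamelson m n c hc a b,
      ∃ q : Fin (Fintype.card (Fin c × (Fin (m + n) × Fin (m + n))) - (m * n - ∑ k, lam k)) →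
        MvPolynomial (Fin c × (Fin (m + n) × Fin (m + n))) ℚ,
      (∀ j, ∀ x ∈ BottSamelson m n c hc a b, aeval x (q j) = 0) ∧
      LinearIndependent ℝ (fun j => polyGradQ (q j) z) ∧
      ∃ U : Set (Fin c × (Fin (m + n) × Fin (m + n)) → ℝ), IsOpen U ∧ z ∈ U ∧
        BottSamelson m n c hc a b ∩ U = {x ∈ U | ∀ j, aeval x (q j) = 0} := by
    intro z hz
    choose J hJcard hJli hJloc using fun t : Fin c => exists_chainStepPoly_basis hc hsa hsb hz t
    let Q : (Σ t : Fin c, J t) → MvPolynomial (Fin c × (Fin (m + n) × Fin (m + n))) ℚ := fun j =>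
      chainStepPoly hc (partialSum a (j.1 + 1) + partialSum b (j.1 + 1)) j.1 j.2.1.1 j.2.1.2
    have hcard : Fintype.card (Σ t : Fin c, J t) =
        Fintype.card (Fin c × (Fin (m + n) × Fin (m + n))) - (m * n - ∑ k, lam k) := by
      have h1 : ∑ t, (J t).card + ∑ t, a t * partialSum b (t + 1) =
          Fintype.card (Fin c × (Fin (m + n) × Fin (m + n))) := by
        rw [← Finset.sum_add_distrib, Finset.sum_congr rfl fun t _ => hJcard t,
          Fintype.card_prod (Fin c)]
        simp
      have h2 : ∑ t, a t * partialSum b (t + 1) + ∑ k, lam k = m * n := by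
        rw [sum_eq_sum_mul_of_blocks a hsa lam _ hcompat, ← Finset.sum_add_distrib, ← hsa,
          Finset.sum_mul]
        refine Finset.sum_congr rfl fun t _ => ?_
        rw [← mul_add, partialSum_add_tail, hsb]
      rw [Fintype.card_sigma]
      simp only [Fintype.card_coe]
      omega
    let e := Fintype.equivFinOfCardEq hcard
    have hQli : LinearIndependent ℝ fun j => polyGradQ (Q j) z :=
      linearIndependent_of_slot_triangular (fun j => polyGradQ (Q j) z)
        (fun t => chainSlot hc (t + 1)) hJli
        fun r t hrt j i => polyGradQ_chainStepPoly_eq_zero hc z _ hrt t.2 _ _ i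
    have hvanish : ∀ j, ∀ x ∈ BottSamelson m n c hc a b, aeval x (Q j) = 0 := by
      intro j x hx
      rw [aeval_chainStepPoly, ((mem_bottSamelson_iff_projStep hc hsa hsb x).1 hx).1 j.1 j.1.2]
      rfl
    have htrace : ∀ t : Fin c, ∀ᶠ x in nhds z,
        |(chainMat hc x (t + 1)).trace - partialSum a (t + 1)| < 1 := by
      intro t
      have hcont : Continuous fun x : Fin c × (Fin (m + n) × Fin (m + n)) → ℝ =>
          |(chainMat hc x (t + 1)).trace - partialSum a (t + 1)| :=
        ((continuous_chainMat hc _).matrix_trace.sub continuous_const).abs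
      refine hcont.continuousAt.eventually (Iio_mem_nhds ?_)
      beta_reduce
      rw [((mem_bottSamelson_iff_projStep hc hsa hsb z).1 hz).2 t t.2, sub_self, abs_zero]
      exact one_pos
    obtain ⟨U, hU, hUo, hzU⟩ := eventually_nhds_iff.1
      ((Filter.eventually_all.2 hJloc).and (Filter.eventually_all.2 htrace))
    refine ⟨fun j => Q (e.symm j), fun j => hvanish _, hQli.comp _ e.symm.injective, U, hUo, hzU,
      ?_⟩
    ext x
    constructor
    · rintro ⟨hx, hxU⟩
      exact ⟨hxU, fun j => hvanish _ x hx⟩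
    · rintro ⟨hxU, hxq⟩
      refine ⟨?_, hxU⟩
      obtain ⟨hx1, hx2⟩ := hU x hxU
      have hQ : ∀ j, aeval x (Q j) = 0 := fun j => by simpa using hxq (e j)
      have hchain := isProj_of_projStep (c := c) (Y := chainMat hc x)
        (d := fun t => partialSum a t + partialSum b t) (partialSum_add_mono a b)
        (chainMat_zero hc x) fun t ht => hx1 ⟨t, ht⟩ fun j hj => hQ ⟨⟨t, ht⟩, ⟨j, hj⟩⟩
      rw [mem_bottSamelson_iff_projStep hc hsa hsb]
      exact ⟨projStep_eq_zero_of_isProj (Y := chainMat hc x)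
        (d := fun t => partialSum a t + partialSum b t) (partialSum_add_mono a b) hchain.1 hchain.2,
        fun t ht => trace_eq_of_abs_sub_lt_one (hchain.1 (t + 1) ht).2.1 (hx2 ⟨t, ht⟩)⟩
  exact ⟨isProjQClosed_bottSamelson hc hsa hsb, isQAlgebraicSet_bottSamelson hc hsa hsb,
    isSmoothSubmanifold_of_local_equations hlocal, hlocal⟩
end
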